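/- arXiv:1809.07919 — 2 statements merged into one kernel-verified Lean document; each statement's English description precedes it below -/
import Mathlib

section
/- Let $B$ be the open unit ball in $\mathbb{C}^n$ and $\alpha\in(0,1]$. Suppose $u\in C^2(B)\cap C(\bar B)$ is plurisubharmonic on $B$ and satisfies $\det(u_{i\bar j})=f$ in $B$ and $u=\varphi$ on $\partial B$, where $\varphi\in C^{0,\alpha}(\partial B)$, $f\geq 0$ and $f^{1/n}\in C^{0,\alpha}(\bar B)$. Then for every $t\in(0,1]$ there is a constant $C=C(n,t)$ depending only on $n$ and $t$ such that for all $x_1,x_2\in B$ with $|x_1|<1-t$ and $|x_2|<1-t$: $|u(x_1)-u(x_2)|\leq C\,([\varphi]_{0,\alpha;\partial B}+|f^{1/n}|'_{0,\alpha;B})\,|x_1-x_2|^{\alpha}$. -/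
open Metric Set
open scoped ComplexOrder

/-- The complex Hessian matrix `(u_{i j̄})` of a function `u : ℂⁿ → ℝ`, where
`u_{i j̄} = ∂²u/∂z_i∂z̄_j = (1/4)(u_{xᵢxⱼ} + u_{yᵢyⱼ} + i (u_{xᵢyⱼ} - u_{yᵢxⱼ}))`,
computed via real Fréchet derivatives. -/
noncomputable def cxHessian (n : ℕ) (u : EuclideanSpace ℂ (Fin n) → ℝ)
    (z : EuclideanSpace ℂ (Fin n)) : Matrix (Fin n) (Fin n) ℂ :=
  Matrix.of fun i j =>
    (1 / 4 : ℂ) *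
      (Complex.ofReal
          ((fderiv ℝ (fun w => fderiv ℝ u w (EuclideanSpace.single j (1 : ℂ))) z)
              (EuclideanSpace.single i (1 : ℂ))
            + (fderiv ℝ (fun w => fderiv ℝ u w (EuclideanSpace.single j Complex.I)) z)
              (EuclideanSpace.single i Complex.I))
        + Complex.I *
          Complex.ofReal
            ((fderiv ℝ (fun w => fderiv ℝ u w (EuclideanSpace.single j Complex.I)) z)
                (EuclideanSpace.single i (1 : ℂ))
              - (fderiv ℝ (fun w => fderiv ℝ u w (EuclideanSpace.single j (1 : ℂ))) z)
                (EuclideanSpace.single i Complex.I)))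

theorem Matrix.IsHermitian.det_add_smul_one {ι : Type*} [Fintype ι] [DecidableEq ι]
    {A : Matrix ι ι ℂ} (hA : A.IsHermitian) (c : ℝ) :
    (A + (c : ℂ) • (1 : Matrix ι ι ℂ)).det = ((∏ i, (hA.eigenvalues i + c) : ℝ) : ℂ) := by
  have h : A + (c : ℂ) • (1 : Matrix ι ι ℂ) =
      Unitary.conjStarAlgAut ℂ (Matrix ι ι ℂ) hA.eigenvectorUnitary
        (Matrix.diagonal (fun i => ((hA.eigenvalues i + c : ℝ) : ℂ))) := by
    conv_lhs => rw [hA.spectral_theorem]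
    rw [← map_one (Unitary.conjStarAlgAut ℂ (Matrix ι ι ℂ) hA.eigenvectorUnitary), ← map_smul,
      ← map_add]
    congr 1
    ext i j
    by_cases hij : i = j
    · subst hij; simp
    · simp [hij]
  rw [h, Unitary.conjStarAlgAut_apply, Matrix.det_mul_right_comm,
    Unitary.mul_star_self_of_mem hA.eigenvectorUnitary.2, one_mul, Matrix.det_diagonal]
  push_cast
  rfl

theorem Matrix.PosSemidef.one_le_det_one_add {ι : Type*} [Fintype ι] [DecidableEq ι]
    {N : Matrix ι ι ℂ} (hN : N.PosSemidef) : 1 ≤ (1 + N).det := by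
  have h := hN.isHermitian.det_add_smul_one 1
  rw [Complex.ofReal_one, one_smul, add_comm] at h
  rw [h]
  have : (1 : ℝ) ≤ ∏ i, (hN.isHermitian.eigenvalues i + 1) := by
    refine le_of_eq_of_le (Finset.prod_const_one (ι := ι) (s := Finset.univ)).symm ?_
    exact Finset.prod_le_prod (fun _ _ => zero_le_one)
      fun i _ => le_add_of_nonneg_left (hN.eigenvalues_nonneg i)
  exact_mod_cast this

open scoped MatrixOrder Matrix.Norms.L2Operator in
theorem Matrix.PosDef.det_le_det_add {ι : Type*} [Fintype ι] [DecidableEq ι]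
    {P N : Matrix ι ι ℂ} (hP : P.PosDef) (hN : N.PosSemidef) : P.det ≤ (P + N).det := by
  obtain ⟨S, hS, rfl⟩ : ∃ S : Matrix ι ι ℂ, IsUnit S.det ∧ P = S.conjTranspose * S := by
    obtain ⟨S, hS⟩ := CStarAlgebra.nonneg_iff_eq_star_mul_self.mp hP.posSemidef.nonneg
    refine ⟨S, isUnit_iff_ne_zero.2 fun h0 => hP.det_pos.ne' ?_, hS⟩
    rw [hS, Matrix.det_mul, h0, mul_zero]
  have h : S.conjTranspose * S + N =
      S.conjTranspose * (1 + (S⁻¹).conjTranspose * N * S⁻¹) * S := by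
    have h1 : S⁻¹ * S = 1 := Matrix.nonsing_inv_mul S hS
    have h2 : S.conjTranspose * (S⁻¹).conjTranspose = 1 := by
      rw [← Matrix.conjTranspose_mul, h1, Matrix.conjTranspose_one]
    calc _ = S.conjTranspose * S + (S.conjTranspose * (S⁻¹).conjTranspose) * N * (S⁻¹ * S) := by
          rw [h1, h2]; simp
      _ = _ := by noncomm_ring
  have h3 := (hN.conjTranspose_mul_mul_same S⁻¹).one_le_det_one_add
  have h4 := hP.det_pos.le
  calc _ = (S.conjTranspose * S).det * 1 := (mul_one _).symm
    _ ≤ (S.conjTranspose * S).det * (1 + (S⁻¹).conjTranspose * N * S⁻¹).det :=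
      mul_le_mul_of_nonneg_left h3 h4
    _ = _ := by rw [h]; simp only [Matrix.det_mul]; ring

theorem add_le_of_prod_add_eq_pow {ι : Type*} [Fintype ι] [Nonempty ι] {l : ι → ℝ}
    (hl : ∀ i, 0 ≤ l i) {b M : ℝ} (hb : 0 ≤ b) (hM : 0 < M)
    (hlb : ∏ i, l i = b ^ Fintype.card ι) :
    (b + M) ^ Fintype.card ι ≤ ∏ i, (l i + M) := by
  have hp : ∀ i, 0 < l i + M := fun i => by linarith [hl i]
  have hc : (0 : ℝ) < Fintype.card ι := by exact_mod_cast Fintype.card_pos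
  set p : ℝ := (∏ i, (l i + M)) ^ ((Fintype.card ι : ℝ)⁻¹) with hpdef
  have hP : 0 < ∏ i, (l i + M) := Finset.prod_pos fun i _ => hp i
  have hp0 : 0 < p := Real.rpow_pos_of_pos hP _
  have hpn : p ^ Fintype.card ι = ∏ i, (l i + M) :=
    Real.rpow_inv_natCast_pow hP.le Fintype.card_ne_zero
  have amgm : ∀ z : ι → ℝ, (∀ i, 0 ≤ z i) → ∀ q : ℝ, 0 ≤ q → ∏ i, z i = q ^ Fintype.card ι →
      q ≤ (∑ i, z i) / Fintype.card ι := by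
    intro z hz q hq hzq
    have := Real.geom_mean_le_arith_mean Finset.univ (fun _ => 1) z (fun _ _ => zero_le_one)
      (by simpa using hc) (fun i _ => hz i)
    simp only [Real.rpow_one, one_mul, Finset.sum_const, Finset.card_univ, nsmul_eq_mul,
      mul_one] at this
    rwa [hzq, Real.pow_rpow_inv_natCast hq Fintype.card_ne_zero] at this
  have h1 := amgm (fun i => l i / (l i + M)) (fun i => div_nonneg (hl i) (hp i).le) (b / p)
    (by positivity) (by rw [Finset.prod_div_distrib, hlb, div_pow, hpn])
  have h2 := amgm (fun i => M / (l i + M)) (fun i => div_nonneg hM.le (hp i).le) (M / p)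
    (by positivity) (by rw [Finset.prod_div_distrib, div_pow, hpn]; simp)
  have h3 : (∑ i, l i / (l i + M)) / Fintype.card ι + (∑ i, M / (l i + M)) / Fintype.card ι =
      1 := by
    rw [← add_div, ← Finset.sum_add_distrib]
    have : ∀ i, l i / (l i + M) + M / (l i + M) = 1 := fun i => by
      rw [← add_div, div_self (hp i).ne']
    simp [this, hc.ne']
  have h4 : (b + M) / p ≤ 1 := by rw [add_div]; linarith
  rw [← hpn]
  exact pow_le_pow_left₀ (by positivity) ((div_le_one hp0).1 h4) _

theorem Matrix.PosSemidef.add_le_of_det_eq_pow {ι : Type*} [Fintype ι] [DecidableEq ι]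
    [Nonempty ι] {A B : Matrix ι ι ℂ} (hB : B.PosSemidef) {M a b : ℝ} (hM : 0 < M)
    (hAB : (A - B - (M : ℂ) • (1 : Matrix ι ι ℂ)).PosSemidef) (ha : 0 ≤ a) (hb : 0 ≤ b)
    (hAa : A.det = ((a ^ Fintype.card ι : ℝ) : ℂ)) (hBb : B.det = ((b ^ Fintype.card ι : ℝ) : ℂ)) :
    b + M ≤ a := by
  have hP : (B + (M : ℂ) • (1 : Matrix ι ι ℂ)).PosDef :=
    Matrix.PosDef.posSemidef_add hB (Matrix.PosDef.one.smul (by exact_mod_cast hM))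
  have h1 := hP.det_le_det_add hAB
  rw [show B + (M : ℂ) • (1 : Matrix ι ι ℂ) + (A - B - (M : ℂ) • (1 : Matrix ι ι ℂ)) = A by abel,
    hB.isHermitian.det_add_smul_one, hAa] at h1
  have h2 : ∏ i, (hB.isHermitian.eigenvalues i + M) ≤ a ^ Fintype.card ι := by exact_mod_cast h1
  have h3 : ∏ i, hB.isHermitian.eigenvalues i = b ^ Fintype.card ι := by
    have := hB.isHermitian.det_eq_prod_eigenvalues
    rw [hBb] at this
    apply Complex.ofReal_injective
    rw [this]; simp
  have h4 := add_le_of_prod_add_eq_pow hB.eigenvalues_nonneg hb hM h3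
  exact le_of_pow_le_pow_left₀ Fintype.card_ne_zero ha (h4.trans h2)

/-- Four times the Levi form of `u` at `z`, evaluated on the vector `v`. -/
noncomputable def leviForm {E : Type*} [NormedAddCommGroup E] [NormedSpace ℝ E]
    [NormedSpace ℂ E] (u : E → ℝ) (z v : E) : ℝ :=
  fderiv ℝ (fderiv ℝ u) z v v + fderiv ℝ (fderiv ℝ u) z (Complex.I • v) (Complex.I • v)

theorem ContDiffAt.differentiableAt_fderiv {E F : Type*} [NormedAddCommGroup E] [NormedSpace ℝ E]
    [NormedAddCommGroup F] [NormedSpace ℝ F] {u : E → F} {z : E} (hu : ContDiffAt ℝ 2 u z) :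
    DifferentiableAt ℝ (fderiv ℝ u) z :=
  (hu.fderiv_right (m := 1) (by norm_num)).differentiableAt (by norm_num)

theorem re_dotProduct_cxHessian {n : ℕ} {u : EuclideanSpace ℂ (Fin n) → ℝ}
    {z : EuclideanSpace ℂ (Fin n)} (hu : ContDiffAt ℝ 2 u z) (v : EuclideanSpace ℂ (Fin n)) :
    (star v.ofLp ⬝ᵥ (cxHessian n u z).transpose.mulVec v.ofLp).re = leviForm u z v / 4 := by
  have hd := hu.differentiableAt_fderiv
  have key : ∀ e w : EuclideanSpace ℂ (Fin n),
      fderiv ℝ (fun x => fderiv ℝ u x e) z w = fderiv ℝ (fderiv ℝ u) z w e := by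
    intro e w
    rw [fderiv_clm_apply hd (differentiableAt_const e)]
    simp
  set Q := fderiv ℝ (fderiv ℝ u) z with hQ
  set e : Fin n → EuclideanSpace ℂ (Fin n) := fun i => EuclideanSpace.single i (1 : ℂ) with he
  set d : Fin n → EuclideanSpace ℂ (Fin n) := fun i => EuclideanSpace.single i Complex.I with hdd
  have hv : v = ∑ i, ((v i).re • e i + (v i).im • d i) := by
    ext k
    simp [he, hdd, Finset.sum_add_distrib, Pi.single_apply]
  have hIv : Complex.I • v = ∑ i, ((-(v i).im) • e i + (v i).re • d i) := by
    ext k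
    simp [he, hdd, Finset.sum_add_distrib, Pi.single_apply]
    apply Complex.ext <;> simp
  have hQQ : ∀ a b : Fin n → ℝ, Q (∑ i, (a i • e i + b i • d i)) (∑ i, (a i • e i + b i • d i)) =
      ∑ i, ∑ j, (a i * a j * Q (e i) (e j) + a i * b j * Q (e i) (d j) +
        b i * a j * Q (d i) (e j) + b i * b j * Q (d i) (d j)) := by
    intro a b
    simp only [map_sum, sum_apply]
    rw [Finset.sum_comm]
    refine Finset.sum_congr rfl fun i _ => Finset.sum_congr rfl fun j _ => ?_
    simp
    ring
  rw [leviForm, hIv]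
  nth_rewrite 3 4 [hv]
  rw [← hQ, hQQ, hQQ]
  simp only [dotProduct, Matrix.mulVec, Matrix.transpose_apply, Complex.re_sum, Finset.mul_sum]
  rw [Finset.sum_comm, ← Finset.sum_add_distrib, Finset.sum_div]
  refine Finset.sum_congr rfl fun i _ => ?_
  rw [← Finset.sum_add_distrib, Finset.sum_div]
  refine Finset.sum_congr rfl fun j _ => ?_
  simp only [cxHessian, Matrix.of_apply, key]
  rw [show EuclideanSpace.single i (1 : ℂ) = e i from rfl,
    show EuclideanSpace.single j (1 : ℂ) = e j from rfl,
    show EuclideanSpace.single i Complex.I = d i from rfl,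
    show EuclideanSpace.single j Complex.I = d j from rfl]
  simp
  ring

theorem leviForm_comp {E F : Type*} [NormedAddCommGroup E] [NormedSpace ℝ E]
    [NormedSpace ℂ E] [IsScalarTower ℝ ℂ E] [NormedAddCommGroup F] [NormedSpace ℝ F]
    [NormedSpace ℂ F] [IsScalarTower ℝ ℂ F]
    {u : F → ℝ} {ψ : E → F} {w : E}
    (hu : ContDiffAt ℝ 2 u (ψ w)) (hψ : ContDiffAt ℂ 2 ψ w) (v : E) :
    leviForm (u ∘ ψ) w v = leviForm u (ψ w) (fderiv ℂ ψ w v) := by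
  have hψr : ContDiffAt ℝ 2 ψ w := hψ.restrict_scalars ℝ
  have h1 : ∀ᶠ y in nhds w, DifferentiableAt ℂ ψ y :=
    (hψ.eventually (by simp)).mono fun y hy => hy.differentiableAt (by norm_num)
  have h2 : ∀ᶠ y in nhds w, DifferentiableAt ℝ u (ψ y) :=
    hψ.continuousAt.eventually
      ((hu.eventually (by simp)).mono fun y hy => hy.differentiableAt (by norm_num))
  have h3 : fderiv ℝ (u ∘ ψ) =ᶠ[nhds w] fun y => (fderiv ℝ u (ψ y)).comp (fderiv ℝ ψ y) := by
    filter_upwards [h1, h2] with y hy1 hy2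
    exact fderiv_comp y hy2 (hy1.restrictScalars ℝ)
  have h4 : HasFDerivAt (fun y => fderiv ℝ u (ψ y))
      ((fderiv ℝ (fderiv ℝ u) (ψ w)).comp (fderiv ℝ ψ w)) w :=
    hu.differentiableAt_fderiv.hasFDerivAt.comp w
      (hψr.differentiableAt (by norm_num)).hasFDerivAt
  have h5 := h4.clm_comp hψr.differentiableAt_fderiv.hasFDerivAt
  have h6 : fderiv ℝ (fderiv ℝ ψ) w (Complex.I • v) (Complex.I • v) =
      -fderiv ℝ (fderiv ℝ ψ) w v v := by
    have h7 : fderiv ℝ ψ =ᶠ[nhds w] fun y => (fderiv ℂ ψ y).restrictScalars ℝ := by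
      filter_upwards [h1] with y hy using hy.fderiv_restrictScalars ℝ
    have h8 : DifferentiableAt ℂ (fderiv ℂ ψ) w :=
      (hψ.fderiv_right (m := 1) (by norm_num)).differentiableAt (by norm_num)
    have h9 : ∀ x y : E, fderiv ℝ (fderiv ℝ ψ) w x y = fderiv ℂ (fderiv ℂ ψ) w x y := by
      intro x y
      have h10 : HasFDerivAt (fun y => (fderiv ℂ ψ y).restrictScalars ℝ)
          ((ContinuousLinearMap.restrictScalarsL ℂ E F ℝ ℝ).comp
            ((fderiv ℂ (fderiv ℂ ψ) w).restrictScalars ℝ)) w :=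
        (ContinuousLinearMap.restrictScalarsL ℂ E F ℝ ℝ).hasFDerivAt.comp w
          (h8.hasFDerivAt.restrictScalars ℝ)
      rw [h7.fderiv_eq, h10.fderiv]
      rfl
    rw [h9, h9]
    simp [smul_smul]
  have h11 : fderiv ℝ ψ w = (fderiv ℂ ψ w).restrictScalars ℝ :=
    h1.self_of_nhds.fderiv_restrictScalars ℝ
  rw [leviForm, leviForm, h3.fderiv_eq, h5.fderiv]
  simp [h6, h11]
  ring

theorem IsLocalMax.fderiv_fderiv_nonpos {E : Type*} [NormedAddCommGroup E] [NormedSpace ℝ E]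
    {F : E → ℝ} {z : E} (hF : ContDiffAt ℝ 2 F z) (hmax : IsLocalMax F z) (v : E) :
    fderiv ℝ (fderiv ℝ F) z v v ≤ 0 := by
  by_contra! hpos
  set q := fderiv ℝ (fderiv ℝ F) z v v with hq
  have hline : ∀ s : ℝ, HasDerivAt (fun s : ℝ => z + s • v) v s := fun s => by
    simpa using ((hasDerivAt_id s).smul_const v).const_add z
  have hc : Filter.Tendsto (fun s : ℝ => z + s • v) (nhds 0) (nhds z) := by
    simpa using (hline 0).continuousAt.tendsto
  set G : ℝ → ℝ := fun s => F (z + s • v) - q / 4 * s ^ 2 with hG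
  have h1 : ∀ᶠ s in nhds (0 : ℝ), HasDerivAt G (fderiv ℝ F (z + s • v) v - q / 2 * s) s := by
    filter_upwards [hc.eventually (hF.eventually (by simp))] with s hs
    have ha : HasDerivAt (fun s : ℝ => F (z + s • v)) (fderiv ℝ F (z + s • v) v) s :=
      (hs.differentiableAt two_ne_zero).hasFDerivAt.comp_hasDerivAt s (hline s)
    have hb : HasDerivAt (fun s : ℝ => q / 4 * s ^ 2) (q / 2 * s) s :=
      ((hasDerivAt_pow 2 s).const_mul (q / 4)).congr_deriv (by norm_num; ring)
    exact ha.sub hb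
  have h2 : deriv G =ᶠ[nhds 0] fun s => fderiv ℝ F (z + s • v) v - q / 2 * s :=
    h1.mono fun s hs => hs.deriv
  have hFd : HasFDerivAt (fun y => fderiv ℝ F y v)
      ((ContinuousLinearMap.apply ℝ ℝ v).comp (fderiv ℝ (fderiv ℝ F) z)) z :=
    (ContinuousLinearMap.apply ℝ ℝ v).hasFDerivAt.comp z hF.differentiableAt_fderiv.hasFDerivAt
  have h3 : HasDerivAt (fun s : ℝ => fderiv ℝ F (z + s • v) v - q / 2 * s) (q - q / 2) 0 := by
    have ha : HasDerivAt (fun s : ℝ => fderiv ℝ F (z + s • v) v) q 0 :=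
      hFd.comp_hasDerivAt_of_eq (0 : ℝ) (hline 0) (by simp)
    have hb : HasDerivAt (fun s : ℝ => q / 2 * s) (q / 2) 0 :=
      ((hasDerivAt_id (0 : ℝ)).const_mul (q / 2)).congr_deriv (by simp)
    exact ha.sub hb
  have h5 : deriv (deriv G) 0 > 0 := by
    rw [h2.deriv_eq, h3.deriv]; linarith
  have h6 : deriv G 0 = 0 := by
    rw [h1.self_of_nhds.deriv]; simp [hmax.fderiv_eq_zero]
  have h7 := isLocalMin_of_deriv_deriv_pos h5 h6 h1.self_of_nhds.continuousAt
  have h8 : ∀ᶠ s in nhds (0 : ℝ), F (z + s • v) ≤ F z := hc.eventually hmax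
  have h9 : ∀ᶠ s in nhds (0 : ℝ), s = 0 := by
    filter_upwards [h7, h8] with s hs1 hs2
    have : q / 4 * s ^ 2 ≤ 0 := by simp [hG] at hs1; linarith
    by_contra h0
    have : 0 < q / 4 * s ^ 2 := by positivity
    linarith
  obtain ⟨ε, hε, hh⟩ := Metric.eventually_nhds_iff.1 h9
  have := hh (y := ε / 2) (by simp [abs_of_pos hε]; linarith)
  linarith

theorem leviForm_const_mul_norm_sq {n : ℕ} (c : ℝ) (z v : EuclideanSpace ℂ (Fin n)) :
    leviForm (fun w => c * ‖w‖ ^ 2) z v = 4 * (c * ‖v‖ ^ 2) := by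
  have h : fderiv ℝ (fun w : EuclideanSpace ℂ (Fin n) => c * ‖w‖ ^ 2) =
      fun w => ((c * 2 : ℝ) • innerSL ℝ : EuclideanSpace ℂ (Fin n) →L[ℝ] _) w := by
    ext x w
    rw [fderiv_const_mul (contDiff_norm_sq ℝ (n := 1)).differentiable_one.differentiableAt,
      fderiv_norm_sq_apply]
    simp [mul_assoc]
  rw [leviForm, h, ContinuousLinearMap.fderiv]
  have hi : ∀ x : EuclideanSpace ℂ (Fin n), innerSL ℝ x x = ‖x‖ ^ 2 :=
    fun x => real_inner_self_eq_norm_sq x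
  simp [hi, norm_smul]
  ring

theorem leviForm_add {E : Type*} [NormedAddCommGroup E] [NormedSpace ℝ E]
    [NormedSpace ℂ E] {u₁ u₂ : E → ℝ} {z : E}
    (h₁ : ContDiffAt ℝ 2 u₁ z) (h₂ : ContDiffAt ℝ 2 u₂ z) (v : E) :
    leviForm (fun w => u₁ w + u₂ w) z v = leviForm u₁ z v + leviForm u₂ z v := by
  have h : fderiv ℝ (fun w => u₁ w + u₂ w) =ᶠ[nhds z] fun w => fderiv ℝ u₁ w + fderiv ℝ u₂ w := by
    filter_upwards [h₁.eventually (by simp), h₂.eventually (by simp)] with y hy₁ hy₂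
    exact fderiv_fun_add (hy₁.differentiableAt (by norm_num)) (hy₂.differentiableAt (by norm_num))
  rw [leviForm, h.fderiv_eq,
    fderiv_fun_add h₁.differentiableAt_fderiv h₂.differentiableAt_fderiv]
  simp [leviForm]
  ring

theorem leviForm_neg_one_mul {E : Type*} [NormedAddCommGroup E] [NormedSpace ℝ E]
    [NormedSpace ℂ E] (u : E → ℝ) (z v : E) :
    leviForm (fun w => (-1) * u w) z v = -leviForm u z v := by
  simp only [neg_one_mul]
  have h : fderiv ℝ (fun w => -u w) = fun w => -fderiv ℝ u w := funext fun w => fderiv_fun_neg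
  rw [leviForm, h, fderiv_fun_neg]
  simp [leviForm]
  ring

/-- The automorphism of the unit ball of `ℂⁿ` mapping `0` to `a`. -/
noncomputable def ballMobius {n : ℕ} (a w : EuclideanSpace ℂ (Fin n)) :
    EuclideanSpace ℂ (Fin n) :=
  (1 + inner ℂ a w)⁻¹ • (a + (√(1 - ‖a‖ ^ 2) : ℂ) • w +
    (inner ℂ a w / (1 + (√(1 - ‖a‖ ^ 2) : ℂ))) • a)

theorem one_add_inner_ne_zero {E : Type*} [NormedAddCommGroup E] [InnerProductSpace ℂ E]
    {a w : E} (ha : ‖a‖ < 1) (hw : ‖w‖ ≤ 1) : 1 + inner ℂ a w ≠ 0 := by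
  intro h
  have h1 : inner ℂ a w = -1 := by linear_combination h
  have h2 := norm_inner_le_norm (𝕜 := ℂ) a w
  rw [h1, norm_neg, norm_one] at h2
  nlinarith [norm_nonneg a, norm_nonneg w]

theorem one_add_sqrt_ne_zero (x : ℝ) : (1 + (√x : ℂ)) ≠ 0 := by
  have : (0 : ℝ) < 1 + √x := by positivity
  exact_mod_cast this.ne'

section

variable {n : ℕ} {a w : EuclideanSpace ℂ (Fin n)}

@[simp]
theorem ballMobius_zero (a : EuclideanSpace ℂ (Fin n)) : ballMobius a 0 = a := by
  simp [ballMobius]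

theorem norm_ballMobius_sq (ha : ‖a‖ < 1) (hw : ‖w‖ ≤ 1) :
    (1 - ‖ballMobius a w‖ ^ 2) * ‖1 + inner ℂ a w‖ ^ 2 = (1 - ‖a‖ ^ 2) * (1 - ‖w‖ ^ 2) := by
  have hD := one_add_inner_ne_zero ha hw
  have hs2 : √(1 - ‖a‖ ^ 2) ^ 2 = 1 - ‖a‖ ^ 2 :=
    Real.sq_sqrt (by nlinarith [norm_nonneg a])
  have hs1 : 0 < 1 + √(1 - ‖a‖ ^ 2) := by positivity
  rw [ballMobius, norm_smul, norm_inv]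
  have hD' : ‖1 + inner ℂ a w‖ ≠ 0 := norm_ne_zero_iff.2 hD
  set s := √(1 - ‖a‖ ^ 2) with hs
  set τ := inner ℂ a w with hτ
  have hN : a + (s : ℂ) • w + (τ / (1 + (s : ℂ))) • a =
      (s : ℂ) • w + (1 + τ / (1 + (s : ℂ))) • a := by module
  have h1 : ‖a + (s : ℂ) • w + (τ / (1 + (s : ℂ))) • a‖ ^ 2 =
      s ^ 2 * ‖w‖ ^ 2 + ‖a‖ ^ 2 * ‖1 + τ / (1 + (s : ℂ))‖ ^ 2 +
        2 * (s * ((1 + τ / (1 + (s : ℂ))) * (starRingEnd ℂ) τ).re) := by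
    rw [hN, norm_add_sq (𝕜 := ℂ), norm_smul, norm_smul, inner_smul_left, inner_smul_right,
      ← inner_conj_symm w a, ← hτ]
    simp [mul_pow]
    ring
  have h2 : τ / (1 + (s : ℂ)) = ((1 + s)⁻¹ : ℝ) * τ := by
    push_cast; ring
  rw [mul_pow, h1, h2, ← Complex.normSq_eq_norm_sq, ← Complex.normSq_eq_norm_sq]
  have hD'' : Complex.normSq (1 + τ) ≠ 0 := by simpa using hD
  rw [inv_pow, ← Complex.normSq_eq_norm_sq]
  field_simp
  rw [show ‖a‖ ^ 2 = 1 - s ^ 2 by linarith]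
  simp [Complex.normSq_apply]
  field_simp
  ring

theorem ballMobius_mem_ball (ha : ‖a‖ < 1) (hw : ‖w‖ < 1) : ‖ballMobius a w‖ < 1 := by
  have h := norm_ballMobius_sq ha hw.le
  have hD : 0 < ‖1 + inner ℂ a w‖ := norm_pos_iff.2 (one_add_inner_ne_zero ha hw.le)
  have h1 : 0 < (1 - ‖a‖ ^ 2) * (1 - ‖w‖ ^ 2) :=
    mul_pos (by nlinarith [norm_nonneg a]) (by nlinarith [norm_nonneg w])
  rw [← h] at h1
  have h2 := pos_of_mul_pos_left h1 (by positivity)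
  nlinarith [norm_nonneg (ballMobius a w)]

theorem ballMobius_mem_sphere (ha : ‖a‖ < 1) (hw : ‖w‖ = 1) : ‖ballMobius a w‖ = 1 := by
  have h := norm_ballMobius_sq ha hw.le
  have hD : ‖1 + inner ℂ a w‖ ^ 2 ≠ 0 :=
    pow_ne_zero _ (norm_ne_zero_iff.2 (one_add_inner_ne_zero ha hw.le))
  rw [hw, one_pow, sub_self, mul_zero, mul_eq_zero, or_iff_left hD] at h
  exact (sq_eq_sq₀ (norm_nonneg _) zero_le_one).1 (by linarith)

theorem hasFDerivAt_ballMobius (ha : ‖a‖ < 1) (hw : ‖w‖ ≤ 1) :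
    HasFDerivAt (ballMobius a)
      (((√(1 - ‖a‖ ^ 2) : ℂ) / (1 + inner ℂ a w)) •
        (ContinuousLinearMap.id ℂ _ - (innerSL ℂ a).smulRight ((1 + inner ℂ a w)⁻¹ •
          ((1 + (√(1 - ‖a‖ ^ 2) : ℂ))⁻¹ • a + w)))) w := by
  have hD := one_add_inner_ne_zero ha hw
  have hs := one_add_sqrt_ne_zero (1 - ‖a‖ ^ 2)
  set s := √(1 - ‖a‖ ^ 2)
  have h1 : HasFDerivAt (fun y => inner ℂ a y) (innerSL ℂ a) w := (innerSL ℂ a).hasFDerivAt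
  have h2 := (hasDerivAt_inv hD).comp_hasFDerivAt w (h1.const_add 1)
  have h3 := (((hasFDerivAt_id w).const_smul (s : ℂ)).const_add a).add
    ((h1.mul_const (1 + (s : ℂ))⁻¹).smul_const a)
  refine (h2.smul h3).congr_fderiv ?_
  ext1 v
  simp
  match_scalars
  · field_simp
    rfl
  · field_simp
    ring
  · field_simp
    rfl

theorem contDiffAt_ballMobius (ha : ‖a‖ < 1) (hw : ‖w‖ ≤ 1) :
    ContDiffAt ℂ 2 (ballMobius a) w := by
  have h : ContDiffAt ℂ 2 (fun y => inner ℂ a y) w := (innerSL ℂ a).contDiff.contDiffAt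
  unfold ballMobius
  exact ((contDiffAt_const.add h).inv (one_add_inner_ne_zero ha hw)).smul
    ((contDiffAt_const.add (contDiffAt_id.const_smul _)).add
      ((h.div_const _).smul contDiffAt_const))

theorem exists_matrix_fderiv_ballMobius (ha : ‖a‖ < 1) (hw : ‖w‖ ≤ 1) :
    ∃ J : Matrix (Fin n) (Fin n) ℂ,
      (∀ v, fderiv ℂ (ballMobius a) w v = WithLp.toLp 2 (J.mulVec v.ofLp)) ∧
      J.det = ((√(1 - ‖a‖ ^ 2) : ℂ) / (1 + inner ℂ a w)) ^ (n + 1) := by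
  have hD := one_add_inner_ne_zero ha hw
  have hs := one_add_sqrt_ne_zero (1 - ‖a‖ ^ 2)
  have hs2 : (√(1 - ‖a‖ ^ 2) : ℂ) ^ 2 = 1 - (‖a‖ : ℂ) ^ 2 := by
    have : √(1 - ‖a‖ ^ 2) ^ 2 = 1 - ‖a‖ ^ 2 := Real.sq_sqrt (by nlinarith [norm_nonneg a])
    exact_mod_cast this
  rw [(hasFDerivAt_ballMobius ha hw).fderiv]
  set s := √(1 - ‖a‖ ^ 2)
  set q : EuclideanSpace ℂ (Fin n) := (1 + inner ℂ a w)⁻¹ • ((1 + (s : ℂ))⁻¹ • a + w) with hq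
  refine ⟨((s : ℂ) / (1 + inner ℂ a w)) •
    (1 + Matrix.replicateCol Unit (-q.ofLp) * Matrix.replicateRow Unit (star a.ofLp)), ?_, ?_⟩
  · intro v
    ext i
    rw [← Matrix.vecMulVec_eq, Matrix.smul_mulVec, Matrix.add_mulVec, Matrix.one_mulVec,
      Matrix.vecMulVec_mulVec, dotProduct_comm, ← EuclideanSpace.inner_eq_star_dotProduct]
    simp
    left
    ring
  · rw [Matrix.det_smul, Matrix.det_one_add_replicateCol_mul_replicateRow, Fintype.card_fin,
      pow_succ]
    congr 1
    have h1 : star a.ofLp ⬝ᵥ q.ofLp = inner ℂ a q := by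
      rw [EuclideanSpace.inner_eq_star_dotProduct, dotProduct_comm]
    rw [dotProduct_neg, h1, hq, inner_smul_right, inner_add_right, inner_smul_right,
      inner_self_eq_norm_sq_to_K]
    simp only [Complex.coe_algebraMap]
    rw [show ((‖a‖ : ℂ)) ^ 2 = 1 - (s : ℂ) ^ 2 by rw [hs2]; ring]
    field_simp
    ring

theorem exists_lipschitz_ballMobius (n : ℕ) {t : ℝ} (ht : 0 < t) :
    ∃ L : ℝ, 1 ≤ L ∧ ∀ a b w : EuclideanSpace ℂ (Fin n), ‖a‖ ≤ 1 - t → ‖b‖ ≤ 1 - t → ‖w‖ ≤ 1 →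
      ‖ballMobius a w - ballMobius b w‖ ≤ L * ‖a - b‖ := by
  set K : Set (EuclideanSpace ℂ (Fin n) × EuclideanSpace ℂ (Fin n)) :=
    closedBall 0 (1 - t) ×ˢ closedBall 0 1 with hK
  have hK1 : ∀ p ∈ K, ‖p.1‖ < 1 ∧ ‖p.2‖ ≤ 1 := by
    rintro p ⟨h1, h2⟩
    rw [mem_closedBall_zero_iff] at h1 h2
    exact ⟨by linarith, h2⟩
  have hcd : ContDiffOn ℝ 1 (fun p : EuclideanSpace ℂ (Fin n) × EuclideanSpace ℂ (Fin n) =>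
      ballMobius p.1 p.2) K := by
    intro p hp
    obtain ⟨h1, h2⟩ := hK1 p hp
    apply ContDiffAt.contDiffWithinAt
    have hτ : ContDiffAt ℝ 1 (fun p : EuclideanSpace ℂ (Fin n) × EuclideanSpace ℂ (Fin n) =>
      inner ℂ p.1 p.2) p := contDiffAt_fst.inner ℂ contDiffAt_snd
    have hs : ContDiffAt ℝ 1 (fun p : EuclideanSpace ℂ (Fin n) × EuclideanSpace ℂ (Fin n) =>
      ((√(1 - ‖p.1‖ ^ 2) : ℝ) : ℂ)) p :=
      Complex.ofRealCLM.contDiff.contDiffAt.comp p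
        ((contDiffAt_const.sub (contDiffAt_fst.norm_sq ℝ)).sqrt
          (by nlinarith [norm_nonneg p.1]))
    unfold ballMobius
    exact ((contDiffAt_const.add hτ).inv (one_add_inner_ne_zero h1 h2)).smul
      ((contDiffAt_fst.add (hs.smul contDiffAt_snd)).add
        ((hτ.mul ((contDiffAt_const.add hs).inv (one_add_sqrt_ne_zero _))).smul contDiffAt_fst))
  obtain ⟨L, hL⟩ := hcd.exists_lipschitzOnWith (by norm_num)
    ((convex_closedBall _ _).prod (convex_closedBall _ _))
    ((isCompact_closedBall _ _).prod (isCompact_closedBall _ _))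
  refine ⟨max 1 L, le_max_left _ _, fun a b w ha hb hw => ?_⟩
  have := hL.dist_le_mul (a, w) ⟨by simpa using ha, by simpa using hw⟩
    (b, w) ⟨by simpa using hb, by simpa using hw⟩
  rw [dist_prod_same_right, dist_eq_norm, dist_eq_norm] at this
  exact this.trans (mul_le_mul_of_nonneg_right (le_max_right _ _) (norm_nonneg _))

/-- The `n`-th root of the squared modulus of the Jacobian determinant of `ballMobius a`. -/
noncomputable def ballMobiusFactor (a w : EuclideanSpace ℂ (Fin n)) : ℝ :=
  ((1 - ‖a‖ ^ 2) / ‖1 + inner ℂ a w‖ ^ 2) ^ (((n + 1 : ℕ) : ℝ) * (n : ℝ)⁻¹)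

theorem ballMobiusFactor_nonneg (ha : ‖a‖ < 1) : 0 ≤ ballMobiusFactor a w :=
  Real.rpow_nonneg (div_nonneg (by nlinarith [norm_nonneg a]) (by positivity)) _

theorem ballMobiusFactor_pow (hn : 0 < n) (ha : ‖a‖ < 1) :
    ballMobiusFactor a w ^ n = ‖((√(1 - ‖a‖ ^ 2) : ℂ) / (1 + inner ℂ a w)) ^ (n + 1)‖ ^ 2 := by
  have h0 : 0 ≤ 1 - ‖a‖ ^ 2 := by nlinarith [norm_nonneg a]
  have h1 : 0 ≤ (1 - ‖a‖ ^ 2) / ‖1 + inner ℂ a w‖ ^ 2 := div_nonneg h0 (by positivity)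
  rw [ballMobiusFactor, Real.rpow_mul h1, Real.rpow_natCast,
    Real.rpow_inv_natCast_pow (pow_nonneg h1 _) hn.ne', norm_pow, norm_div, Complex.norm_real,
    Real.norm_of_nonneg (Real.sqrt_nonneg _), ← pow_mul, mul_comm, pow_mul,
    div_pow (√(1 - ‖a‖ ^ 2)), Real.sq_sqrt h0]

theorem exists_lipschitz_ballMobiusFactor (n : ℕ) {t : ℝ} (ht : 0 < t) :
    ∃ L R : ℝ, 0 ≤ L ∧ 0 ≤ R ∧
      ∀ a b w : EuclideanSpace ℂ (Fin n), ‖a‖ ≤ 1 - t → ‖b‖ ≤ 1 - t → ‖w‖ ≤ 1 →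
        |ballMobiusFactor a w - ballMobiusFactor b w| ≤ L * ‖a - b‖ ∧
          ballMobiusFactor a w ≤ R := by
  set K : Set (EuclideanSpace ℂ (Fin n) × EuclideanSpace ℂ (Fin n)) :=
    closedBall 0 (1 - t) ×ˢ closedBall 0 1 with hK
  have hK1 : ∀ p ∈ K, ‖p.1‖ < 1 ∧ ‖p.2‖ ≤ 1 := by
    rintro p ⟨h1, h2⟩
    rw [mem_closedBall_zero_iff] at h1 h2
    exact ⟨by linarith, h2⟩
  have hKc : IsCompact K := (isCompact_closedBall _ _).prod (isCompact_closedBall _ _)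
  have hcd : ContDiffOn ℝ 1 (fun p : EuclideanSpace ℂ (Fin n) × EuclideanSpace ℂ (Fin n) =>
      ballMobiusFactor p.1 p.2) K := by
    intro p hp
    obtain ⟨h1, h2⟩ := hK1 p hp
    apply ContDiffAt.contDiffWithinAt
    have hD := norm_pos_iff.2 (one_add_inner_ne_zero h1 h2)
    have hτ : ContDiffAt ℝ 1 (fun p : EuclideanSpace ℂ (Fin n) × EuclideanSpace ℂ (Fin n) =>
      inner ℂ p.1 p.2) p := contDiffAt_fst.inner ℂ contDiffAt_snd
    have h3 : 0 < 1 - ‖p.1‖ ^ 2 := by nlinarith [norm_nonneg p.1]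
    unfold ballMobiusFactor
    exact ((contDiffAt_const.sub (contDiffAt_fst.norm_sq ℝ)).div
      ((contDiffAt_const.add hτ).norm_sq ℝ) (pow_ne_zero 2 hD.ne')).rpow_const_of_ne
      (div_pos h3 (pow_pos hD 2)).ne'
  obtain ⟨L, hL⟩ := hcd.exists_lipschitzOnWith (by norm_num)
    ((convex_closedBall _ _).prod (convex_closedBall _ _)) hKc
  obtain ⟨R, hR⟩ := hKc.exists_bound_of_continuousOn hcd.continuousOn
  refine ⟨L, max R 0, L.2, le_max_right _ _, fun a b w ha hb hw => ?_⟩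
  have hm : (a, w) ∈ K := ⟨by simpa using ha, by simpa using hw⟩
  have := hL.dist_le_mul (a, w) hm (b, w) ⟨by simpa using hb, by simpa using hw⟩
  rw [dist_prod_same_right, Real.dist_eq, dist_eq_norm] at this
  exact ⟨this, ((le_abs_self _).trans (hR _ hm)).trans (le_max_left _ _)⟩

end

theorem Matrix.re_star_dotProduct_conjTranspose_mul_mul_mulVec {ι : Type*} [Fintype ι]
    (H J : Matrix ι ι ℂ) (v : ι → ℂ) :
    (star v ⬝ᵥ (J.conjTranspose * H * J).mulVec v).re =
      (star (J.mulVec v) ⬝ᵥ H.mulVec (J.mulVec v)).re := by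
  rw [← Matrix.mulVec_mulVec, ← Matrix.mulVec_mulVec, Matrix.dotProduct_mulVec,
    ← Matrix.star_mulVec]

/-- The transposed complex Hessian of `u ∘ ballMobius a` at `w`. -/
theorem exists_hessian_comp_ballMobius {n : ℕ} (hn : 0 < n)
    {u : EuclideanSpace ℂ (Fin n) → ℝ} {a w : EuclideanSpace ℂ (Fin n)} {c : ℝ}
    (ha : ‖a‖ < 1) (hw : ‖w‖ < 1) (hu : ContDiffAt ℝ 2 u (ballMobius a w))
    (hpsd : (cxHessian n u (ballMobius a w)).PosSemidef)
    (hdet : (cxHessian n u (ballMobius a w)).det = ((c ^ n : ℝ) : ℂ)) :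
    ∃ A : Matrix (Fin n) (Fin n) ℂ, A.PosSemidef ∧
      (∀ v : EuclideanSpace ℂ (Fin n),
        (star v.ofLp ⬝ᵥ A.mulVec v.ofLp).re = leviForm (u ∘ ballMobius a) w v / 4) ∧
      A.det = (((c * ballMobiusFactor a w) ^ n : ℝ) : ℂ) := by
  obtain ⟨J, hJ, hJdet⟩ := exists_matrix_fderiv_ballMobius ha hw.le
  refine ⟨J.conjTranspose * (cxHessian n u (ballMobius a w)).transpose * J,
    hpsd.transpose.conjTranspose_mul_mul_same J, fun v => ?_, ?_⟩
  · rw [Matrix.re_star_dotProduct_conjTranspose_mul_mul_mulVec,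
      leviForm_comp hu (contDiffAt_ballMobius ha hw.le), hJ, ← re_dotProduct_cxHessian hu]
  · rw [Matrix.det_mul, Matrix.det_mul, Matrix.det_transpose, Matrix.det_conjTranspose, hdet,
      mul_pow, ballMobiusFactor_pow hn ha, ← hJdet]
    push_cast
    rw [← Complex.conj_mul', starRingEnd_apply]
    ring

/-- At an interior maximum of `u ∘ ballMobius b - u ∘ ballMobius a + M ‖·‖²`, the `n`-th roots of
the Monge–Ampère densities compare. -/
theorem add_le_of_isLocalMax {n : ℕ} (hn : 0 < n)
    {u : EuclideanSpace ℂ (Fin n) → ℝ} {a b w : EuclideanSpace ℂ (Fin n)} {M ca cb : ℝ}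
    (hM : 0 < M) (ha : ‖a‖ < 1) (hb : ‖b‖ < 1) (hw : ‖w‖ < 1)
    (hua : ContDiffAt ℝ 2 u (ballMobius a w)) (hub : ContDiffAt ℝ 2 u (ballMobius b w))
    (hpa : (cxHessian n u (ballMobius a w)).PosSemidef)
    (hpb : (cxHessian n u (ballMobius b w)).PosSemidef)
    (hca : 0 ≤ ca) (hcb : 0 ≤ cb)
    (hda : (cxHessian n u (ballMobius a w)).det = ((ca ^ n : ℝ) : ℂ))
    (hdb : (cxHessian n u (ballMobius b w)).det = ((cb ^ n : ℝ) : ℂ))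
    (hmax : IsLocalMax
      (fun z => u (ballMobius b z) + (-1) * u (ballMobius a z) + M * ‖z‖ ^ 2) w) :
    cb * ballMobiusFactor b w + M ≤ ca * ballMobiusFactor a w := by
  obtain ⟨A, hA, hAv, hAd⟩ := exists_hessian_comp_ballMobius hn ha hw hua hpa hda
  obtain ⟨B, hB, hBv, hBd⟩ := exists_hessian_comp_ballMobius hn hb hw hub hpb hdb
  have : Nonempty (Fin n) := ⟨⟨0, hn⟩⟩
  have hψ : ∀ {c : EuclideanSpace ℂ (Fin n)}, ‖c‖ < 1 → ContDiffAt ℝ 2 u (ballMobius c w) →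
      ContDiffAt ℝ 2 (fun z => u (ballMobius c z)) w := fun hc huc =>
    huc.comp w ((contDiffAt_ballMobius hc hw.le).restrict_scalars ℝ)
  have h1 := hψ hb hub
  have h2 : ContDiffAt ℝ 2 (fun z => (-1) * u (ballMobius a z)) w :=
    contDiffAt_const.mul (hψ ha hua)
  have h3 : ContDiffAt ℝ 2 (fun z : EuclideanSpace ℂ (Fin n) => M * ‖z‖ ^ 2) w :=
    contDiffAt_const.mul (contDiff_norm_sq ℝ).contDiffAt
  have hlevi : ∀ v, leviForm (u ∘ ballMobius b) w v - leviForm (u ∘ ballMobius a) w v +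
      4 * (M * ‖v‖ ^ 2) ≤ 0 := by
    intro v
    have h4 := add_nonpos (hmax.fderiv_fderiv_nonpos ((h1.add h2).add h3) v)
      (hmax.fderiv_fderiv_nonpos ((h1.add h2).add h3) (Complex.I • v))
    rw [← leviForm, leviForm_add (h1.add h2) h3, leviForm_add h1 h2,
      leviForm_const_mul_norm_sq, leviForm_neg_one_mul] at h4
    simp only [Function.comp_def]
    linarith
  have hherm : (A - B - (M : ℂ) • (1 : Matrix (Fin n) (Fin n) ℂ)).IsHermitian :=
    (hA.1.sub hB.1).sub
      (Matrix.PosDef.one.smul (R := ℂ) (α := ℂ) (show (0 : ℂ) < M by exact_mod_cast hM)).1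
  have hpos : (A - B - (M : ℂ) • (1 : Matrix (Fin n) (Fin n) ℂ)).PosSemidef := by
    refine Matrix.PosSemidef.of_dotProduct_mulVec_nonneg hherm fun x => ?_
    have him := hherm.im_star_dotProduct_mulVec_self x
    rw [Complex.nonneg_iff]
    refine ⟨?_, him.symm⟩
    have hx : (star x ⬝ᵥ x).re = ‖WithLp.toLp 2 x‖ ^ 2 := by
      rw [EuclideanSpace.norm_sq_eq]
      simp [dotProduct, ← Complex.normSq_eq_norm_sq, Complex.normSq_apply]
    have h5 := hlevi (WithLp.toLp 2 x)
    have h6 := hAv (WithLp.toLp 2 x)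
    have h7 := hBv (WithLp.toLp 2 x)
    simp only [Matrix.sub_mulVec, Matrix.smul_mulVec, Matrix.one_mulVec, dotProduct_sub,
      dotProduct_smul, Complex.sub_re, smul_eq_mul, Complex.re_ofReal_mul, hx]
    simp only at h6 h7
    linarith
  have hfa := ballMobiusFactor_nonneg (w := w) ha
  have hfb := ballMobiusFactor_nonneg (w := w) hb
  exact hB.add_le_of_det_eq_pow hM hpos (by positivity) (by positivity)
    (by simpa using hAd) (by simpa using hBd)

theorem le_two_mul_rpow {d α : ℝ} (hd0 : 0 ≤ d) (hd : d ≤ 2) (hα : 0 < α) (hα1 : α ≤ 1) :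
    d ≤ 2 * d ^ α := by
  rcases hd0.eq_or_lt with rfl | hpos
  · rw [Real.zero_rpow hα.ne', mul_zero]
  · calc d = d ^ (1 - α) * d ^ α := by rw [← Real.rpow_add hpos]; simp
      _ ≤ 2 * d ^ α := by
        gcongr
        calc d ^ (1 - α) ≤ 2 ^ (1 - α) := Real.rpow_le_rpow hd0 hd (by linarith)
          _ ≤ 2 ^ (1 : ℝ) := Real.rpow_le_rpow_of_exponent_le (by norm_num) (by linarith)
          _ = 2 := Real.rpow_one 2

theorem rpow_le_of_le_mul {x L d α : ℝ} (hx : 0 ≤ x) (hL : 1 ≤ L) (hd : 0 ≤ d) (hα : 0 < α)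
    (hα1 : α ≤ 1) (h : x ≤ L * d) : x ^ α ≤ L * d ^ α :=
  calc x ^ α ≤ (L * d) ^ α := Real.rpow_le_rpow hx h hα.le
    _ = L ^ α * d ^ α := Real.mul_rpow (by linarith) hd
    _ ≤ L * d ^ α := by
      gcongr
      simpa using Real.rpow_le_rpow_of_exponent_le hL hα1

/-- **Interior Hölder estimate on the unit ball** (Lemma 4.1). If `u ∈ PSH(B) ∩ C(B̄)`
solves `det(u_{i j̄}) = f` in the unit ball `B ⊂ ℂⁿ` with `u = φ` on `∂B`,
`φ ∈ C^{0,α}(∂B)`, `f ≥ 0`, `f^{1/n} ∈ C^{0,α}(B̄)`, `α ∈ (0,1]`, then for every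
`t ∈ (0,1]` there is `C = C(n,t)` such that for all `x₁, x₂ ∈ B_{1-t}`:
`|u(x₁) - u(x₂)| ≤ C ([φ]_{0,α;∂B} + |f^{1/n}|'_{0,α;B}) |x₁ - x₂|^α`.
Sup-type seminorms are expressed through arbitrary upper bounds: `Kφ` is a Hölder
constant for `φ` on the sphere, `K₀ ≥ sup_B |f^{1/n}|`, `K₁ ≥ [f^{1/n}]_{0,α;B}`. -/
theorem interior_holder_estimate_unit_ball (n : ℕ) (hn : 0 < n)
    (t : ℝ) (ht0 : 0 < t) (ht1 : t ≤ 1) :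
    ∃ C : ℝ, ∀ (α : ℝ), 0 < α → α ≤ 1 →
      ∀ u f g φ : EuclideanSpace ℂ (Fin n) → ℝ,
      -- u ∈ C²(B) ∩ C(B̄)
      ContDiffOn ℝ 2 u (ball 0 1) →
      ContinuousOn u (closedBall 0 1) →
      -- u is plurisubharmonic on B
      (∀ z ∈ ball (0 : EuclideanSpace ℂ (Fin n)) 1, (cxHessian n u z).PosSemidef) →
      -- the complex Monge-Ampère equation det(u_{i j̄}) = f in B
      (∀ z ∈ ball (0 : EuclideanSpace ℂ (Fin n)) 1, (cxHessian n u z).det = (f z : ℂ)) →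
      -- f ≥ 0 and g = f^{1/n}
      (∀ z ∈ closedBall (0 : EuclideanSpace ℂ (Fin n)) 1, 0 ≤ f z) →
      (∀ z ∈ closedBall (0 : EuclideanSpace ℂ (Fin n)) 1, g z = f z ^ ((n : ℝ)⁻¹)) →
      -- g = f^{1/n} ∈ C^{0,α}(B̄)
      ContinuousOn g (closedBall 0 1) →
      -- φ is continuous on the sphere and u = φ on ∂B
      ContinuousOn φ (sphere 0 1) →
      (∀ z ∈ sphere (0 : EuclideanSpace ℂ (Fin n)) 1, u z = φ z) →
      ∀ Kφ K₀ K₁ : ℝ,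
      (∀ x ∈ sphere (0 : EuclideanSpace ℂ (Fin n)) 1,
        ∀ y ∈ sphere (0 : EuclideanSpace ℂ (Fin n)) 1,
          |φ x - φ y| ≤ Kφ * ‖x - y‖ ^ α) →
      (∀ x ∈ ball (0 : EuclideanSpace ℂ (Fin n)) 1, |g x| ≤ K₀) →
      (∀ x ∈ ball (0 : EuclideanSpace ℂ (Fin n)) 1,
        ∀ y ∈ ball (0 : EuclideanSpace ℂ (Fin n)) 1,
          |g x - g y| ≤ K₁ * ‖x - y‖ ^ α) →
      -- conclusion
      ∀ x₁ x₂ : EuclideanSpace ℂ (Fin n), ‖x₁‖ < 1 - t → ‖x₂‖ < 1 - t →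
        |u x₁ - u x₂| ≤ C * (Kφ + (K₀ + K₁)) * ‖x₁ - x₂‖ ^ α := by
  obtain ⟨L, hL1, hL⟩ := exists_lipschitz_ballMobius n ht0
  obtain ⟨L', R, hL'0, hR0, hL'⟩ := exists_lipschitz_ballMobiusFactor n ht0
  refine ⟨L + L * R + 2 * L', ?_⟩
  intro α hα hα1 u f g φ hu huc hpsd hdet hf hg _ _ huφ Kφ K₀ K₁ hφ hK₀ hK₁
  set e : EuclideanSpace ℂ (Fin n) := EuclideanSpace.single ⟨0, hn⟩ 1 with he
  have hen : ‖e‖ = 1 := by simp [he]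
  have nonneg_of : ∀ {K s : ℝ} {p : ℝ}, 0 < s → |p| ≤ K * s ^ α → 0 ≤ K := fun hs h =>
    nonneg_of_mul_nonneg_left ((abs_nonneg _).trans h) (Real.rpow_pos_of_pos hs α)
  have hKφ0 : 0 ≤ Kφ := by
    refine nonneg_of (s := ‖e - -e‖) ?_ (hφ e (by simp [hen]) (-e) (by simp [hen]))
    rw [sub_neg_eq_add, ← two_smul ℝ e, norm_smul, hen]
    norm_num
  have hK₁0 : 0 ≤ K₁ := by
    have hhalf : ‖(1 / 2 : ℝ) • e‖ = 1 / 2 := by rw [norm_smul, hen]; norm_num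
    refine nonneg_of (s := ‖(1 / 2 : ℝ) • e - 0‖) ?_
      (hK₁ ((1 / 2 : ℝ) • e) ?_ 0 (by simp))
    · rw [sub_zero, hhalf]; norm_num
    · rw [mem_ball_zero_iff, hhalf]; norm_num
  have hK₀0 : 0 ≤ K₀ := (abs_nonneg _).trans (hK₀ 0 (by simp))
  have hud : ∀ z : EuclideanSpace ℂ (Fin n), ‖z‖ < 1 → ContDiffAt ℝ 2 u z := fun z hz =>
    hu.contDiffAt (isOpen_ball.mem_nhds (by simpa using hz))
  have hg0 : ∀ z : EuclideanSpace ℂ (Fin n), ‖z‖ < 1 → 0 ≤ g z := fun z hz => by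
    rw [hg z (by simpa using hz.le)]
    exact Real.rpow_nonneg (hf z (by simpa using hz.le)) _
  have hdetg : ∀ z : EuclideanSpace ℂ (Fin n), ‖z‖ < 1 →
      (cxHessian n u z).det = ((g z ^ n : ℝ) : ℂ) := fun z hz => by
    rw [hdet z (by simpa using hz), hg z (by simpa using hz.le),
      Real.rpow_inv_natCast_pow (hf z (by simpa using hz.le)) hn.ne']
  have main : ∀ a b : EuclideanSpace ℂ (Fin n), ‖a‖ < 1 - t → ‖b‖ < 1 - t →
      u b - u a ≤ (L + L * R + 2 * L') * (Kφ + (K₀ + K₁)) * ‖a - b‖ ^ α := by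
    intro a b hat hbt
    have ha : ‖a‖ < 1 := by linarith
    have hb : ‖b‖ < 1 := by linarith
    set d := ‖a - b‖ with hd
    have hd0 : 0 ≤ d := norm_nonneg _
    have hd2 : d ≤ 2 := (norm_sub_le a b).trans (by linarith)
    have hdα : 0 ≤ d ^ α := Real.rpow_nonneg hd0 α
    refine le_of_forall_pos_le_add fun ε hε => ?_
    set m := K₁ * (L * d ^ α) * R + K₀ * (L' * (2 * d ^ α)) with hm
    have hm0 : 0 ≤ m := by positivity
    set h : EuclideanSpace ℂ (Fin n) → ℝ := fun z =>
      u (ballMobius b z) + (-1) * u (ballMobius a z) + (m + ε) * ‖z‖ ^ 2 with hh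
    have hcont : ∀ c : EuclideanSpace ℂ (Fin n), ‖c‖ < 1 →
        ContinuousOn (fun z => u (ballMobius c z)) (closedBall 0 1) := fun c hc => by
      refine huc.comp (fun z hz => (contDiffAt_ballMobius hc
        (by simpa using hz)).continuousAt.continuousWithinAt) fun z hz => ?_
      rw [mem_closedBall_zero_iff] at hz ⊢
      rcases hz.lt_or_eq with hz | hz
      · exact (ballMobius_mem_ball hc hz).le
      · exact (ballMobius_mem_sphere hc hz).le
    have hhc : ContinuousOn h (closedBall 0 1) :=
      ((hcont b hb).add (continuousOn_const.mul (hcont a ha))).add (by fun_prop)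
    obtain ⟨w, hw, hwmax⟩ := (isCompact_closedBall (0 : EuclideanSpace ℂ (Fin n)) 1).exists_isMaxOn
      ⟨0, by simp⟩ hhc
    have h0 : h 0 ≤ h w := hwmax (by simp)
    have hval : h 0 = u b - u a := by simp [hh]; ring
    rw [mem_closedBall_zero_iff] at hw
    have hLw := hL a b w hat.le hbt.le hw
    have hLα := rpow_le_of_le_mul (norm_nonneg _) hL1 hd0 hα hα1 hLw
    rcases hw.lt_or_eq with hw1 | hw1
    · exfalso
      have hψa := ballMobius_mem_ball ha hw1
      have hψb := ballMobius_mem_ball hb hw1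
      have hloc : IsLocalMax h w := hwmax.isLocalMax
        (Filter.mem_of_superset (isOpen_ball.mem_nhds (by simpa using hw1)) ball_subset_closedBall)
      have hle := add_le_of_isLocalMax hn (by positivity) ha hb hw1 (hud _ hψa) (hud _ hψb)
        (hpsd _ (by simpa using hψa)) (hpsd _ (by simpa using hψb)) (hg0 _ hψa) (hg0 _ hψb)
        (hdetg _ hψa) (hdetg _ hψb) hloc
      have e1 : |g (ballMobius a w) - g (ballMobius b w)| ≤ K₁ * (L * d ^ α) :=
        (hK₁ _ (by simpa using hψa) _ (by simpa using hψb)).trans (by gcongr)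
      obtain ⟨e2, e3⟩ := hL' a b w hat.le hbt.le hw
      have e4 : |ballMobiusFactor a w - ballMobiusFactor b w| ≤ L' * (2 * d ^ α) :=
        e2.trans (by gcongr; exact le_two_mul_rpow hd0 hd2 hα hα1)
      have e5 := hK₀ _ (by simpa using hψb)
      have e6 : (g (ballMobius a w) - g (ballMobius b w)) * ballMobiusFactor a w ≤
          K₁ * (L * d ^ α) * R :=
        mul_le_mul ((le_abs_self _).trans e1) e3 (ballMobiusFactor_nonneg ha) (by positivity)
      have e7 : g (ballMobius b w) * (ballMobiusFactor a w - ballMobiusFactor b w) ≤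
          K₀ * (L' * (2 * d ^ α)) := by
        refine (le_abs_self _).trans ?_
        rw [abs_mul]
        exact mul_le_mul e5 e4 (abs_nonneg _) hK₀0
      linarith
    · have hψa := ballMobius_mem_sphere ha hw1
      have hψb := ballMobius_mem_sphere hb hw1
      have e1 : φ (ballMobius b w) - φ (ballMobius a w) ≤ Kφ * (L * d ^ α) := by
        refine (le_abs_self _).trans ?_
        rw [abs_sub_comm]
        exact (hφ _ (by simpa using hψa) _ (by simpa using hψb)).trans (by gcongr)
      have e2 : h w = φ (ballMobius b w) - φ (ballMobius a w) + (m + ε) := by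
        simp only [hh]
        rw [hw1, huφ _ (by simpa using hψb), huφ _ (by simpa using hψa)]
        ring
      have e3 : Kφ * (L * d ^ α) + m ≤ (L + L * R + 2 * L') * (Kφ + (K₀ + K₁)) * d ^ α := by
        have : 0 ≤ (Kφ * (L * R + 2 * L') + K₀ * (L + L * R) + K₁ * (L + 2 * L')) * d ^ α := by
          positivity
        rw [hm]
        linarith
      linarith
  intro x₁ x₂ h₁ h₂
  rw [abs_le]
  have m1 := main x₁ x₂ h₁ h₂
  have m2 := main x₂ x₁ h₂ h₁
  rw [norm_sub_rev x₂ x₁] at m2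
  constructor <;> linarith
end

section
/- Let $B_r(0)$ be a ball in $\mathbb{C}^n$, $\alpha\in(0,1]$, and let $g=(g_{i\bar j})$ be a map from $\overline{B_r(0)}$ to $n\times n$ positive definite Hermitian matrices whose entries belong to $C^{0,\alpha}(\overline{B_r(0)})$ (so $\omega=\mathrm{i}\sum g_{i\bar j}dz_i\wedge d\bar z_j$ is a Hermitian form). Suppose $u\in C^2(B_r(0))\cap C(\overline{B_r(0)})$ satisfies: the matrix $(g_{i\bar j}(z)+u_{i\bar j}(z))$ is positive semidefinite for all $z\in B_r(0)$, $\det(g_{i\bar j}+u_{i\bar j})=f$ in $B_r(0)$ with $f\geq 0$ and $f^{1/n}\in C^{0,\alpha}(\overline{B_r(0)})$, and $u=\varphi$ on $\partial B_r(0)$ with $\varphi\in C^{0,\alpha}(\partial B_r(0))$. Then for every $t\in(0,1)$ there is a constant $C=C(n,t)$ depending only on $n$ and $t$ such that $[u]_{0,\alpha;B_{(1-t)r}(0)}\leq C\,([\varphi]_{0,\alpha;\partial B_r(0)}+r^{2-\alpha}|f^{1/n}|'_{0,\alpha;B_r(0)}+r^{2-\alpha}|g|'_{0,\alpha;B_r(0)})$.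 -/
open Metric Set
open scoped ComplexOrder

namespace InteriorHolder

section MatrixDet

variable {ι : Type*} [Fintype ι]

/-- Superadditivity of the geometric mean against a constant vector. -/
theorem geom_mean_add_le [Nonempty ι] (l : ι → ℝ) (hl : ∀ i, 0 ≤ l i) {δ : ℝ} (hδ : 0 < δ) :
    (∏ i, l i) ^ ((Fintype.card ι : ℝ)⁻¹) + δ ≤
      (∏ i, (l i + δ)) ^ ((Fintype.card ι : ℝ)⁻¹) := by
  have hc : (0 : ℝ) < Fintype.card ι := by exact_mod_cast Fintype.card_pos
  set c := (Fintype.card ι : ℝ)⁻¹ with hcdef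
  have hpos : ∀ i, 0 < l i + δ := fun i => by have := hl i; linarith
  have amgm : ∀ z : ι → ℝ, (∀ i, 0 ≤ z i) → (∏ i, z i) ^ c ≤ ∑ i, c * z i := by
    intro z hz
    have := Real.geom_mean_le_arith_mean_weighted Finset.univ (fun _ => c) z
      (fun _ _ => by positivity) (by simp [hcdef]) (fun i _ => hz i)
    rwa [Real.finsetProd_rpow _ _ (fun i _ => hz i)] at this
  have h1 := amgm (fun i => l i / (l i + δ)) fun i => div_nonneg (hl i) (hpos i).le
  have h2 := amgm (fun i => δ / (l i + δ)) fun i => div_nonneg hδ.le (hpos i).le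
  have hs : (∑ i, c * (l i / (l i + δ))) + ∑ i, c * (δ / (l i + δ)) = 1 := by
    rw [← Finset.sum_add_distrib]
    have : ∀ i, c * (l i / (l i + δ)) + c * (δ / (l i + δ)) = c := fun i => by
      have := (hpos i).ne'
      field_simp
    rw [Finset.sum_congr rfl fun i _ => this i]
    simp [hcdef]
  have hP : 0 < ∏ i, (l i + δ) := Finset.prod_pos fun i _ => hpos i
  rw [Finset.prod_div_distrib, Real.div_rpow (Finset.prod_nonneg fun i _ => hl i) hP.le] at h1
  rw [Finset.prod_div_distrib, Real.div_rpow (Finset.prod_nonneg fun i _ => hδ.le) hP.le] at h2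
  rw [Finset.prod_const, Finset.card_univ, hcdef, Real.pow_rpow_inv_natCast hδ.le
    (Fintype.card_ne_zero), ← hcdef] at h2
  have hPc := Real.rpow_pos_of_pos hP c
  have h3 : (∏ i, l i) ^ c / (∏ i, (l i + δ)) ^ c + δ / (∏ i, (l i + δ)) ^ c ≤ 1 := by linarith
  rwa [← add_div, div_le_one hPc] at h3

variable [DecidableEq ι]

open scoped MatrixOrder in
theorem exists_conjTranspose_mul_self {S : Matrix ι ι ℂ} (hS : S.PosSemidef) :
    ∃ Y : Matrix ι ι ℂ, S = Y.conjTranspose * Y :=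
  CStarAlgebra.nonneg_iff_eq_star_mul_self.mp hS.nonneg

theorem det_add_smul_one {A : Matrix ι ι ℂ} (hA : A.IsHermitian) (δ : ℝ) :
    (A + (δ : ℂ) • 1).det = ((∏ i, (hA.eigenvalues i + δ) : ℝ) : ℂ) := by
  have h := Matrix.eval_charpoly A (-(δ : ℂ))
  rw [hA.charpoly_eq] at h
  have h2 : A + (δ : ℂ) • 1 = -(Matrix.scalar ι (-(δ : ℂ)) - A) := by
    ext i j
    simp [Matrix.one_apply, Matrix.diagonal_apply]
    split_ifs <;> ring
  rw [h2, Matrix.det_neg, ← h, Polynomial.eval_prod, ← Finset.card_univ, ← Finset.prod_const,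
    ← Finset.prod_mul_distrib]
  push_cast
  refine Finset.prod_congr rfl fun i _ => ?_
  simp [add_comm]

theorem det_le_det_add {S D : Matrix ι ι ℂ} (hS : S.PosDef) (hD : D.PosSemidef) :
    S.det ≤ (S + D).det := by
  obtain ⟨Y, hY⟩ := exists_conjTranspose_mul_self hS.posSemidef
  have hSpos := hS.det_pos
  have hYu : IsUnit Y.det := by
    rw [isUnit_iff_ne_zero]
    intro h0
    rw [hY, Matrix.det_mul, h0, mul_zero] at hSpos
    exact lt_irrefl _ hSpos
  have hC : (Y⁻¹.conjTranspose * D * Y⁻¹).PosSemidef := hD.conjTranspose_mul_mul_same _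
  set C := Y⁻¹.conjTranspose * D * Y⁻¹ with hCdef
  have hYY : Y⁻¹ * Y = 1 := Matrix.nonsing_inv_mul _ hYu
  have hYY' : Y.conjTranspose * Y⁻¹.conjTranspose = 1 := by
    rw [← Matrix.conjTranspose_mul, hYY, Matrix.conjTranspose_one]
  have hSD : S + D = Y.conjTranspose * (C + ((1 : ℝ) : ℂ) • 1) * Y := by
    rw [hY, hCdef]
    simp only [Complex.ofReal_one, one_smul, Matrix.mul_add, Matrix.add_mul, Matrix.mul_one]
    rw [show Y.conjTranspose * (Y⁻¹.conjTranspose * D * Y⁻¹) * Y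
      = (Y.conjTranspose * Y⁻¹.conjTranspose) * D * (Y⁻¹ * Y) by simp only [Matrix.mul_assoc],
      hYY, hYY', Matrix.one_mul, Matrix.mul_one, add_comm]
  have hdet : (S + D).det = S.det * (C + ((1 : ℝ) : ℂ) • 1).det := by
    rw [hSD, Matrix.det_mul, Matrix.det_mul, hY, Matrix.det_mul]
    ring
  rw [hdet, det_add_smul_one hC.1]
  refine le_mul_of_one_le_right hSpos.le ?_
  have : (1 : ℝ) ≤ ∏ i, (hC.1.eigenvalues i + 1) :=
    Finset.one_le_prod fun i _ => by have := hC.eigenvalues_nonneg i; linarith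
  exact_mod_cast this

/-- A weak form of Minkowski's determinant inequality. -/
theorem det_rpow_add_le [Nonempty ι] {A B : Matrix ι ι ℂ} (hA : A.PosSemidef) {δ : ℝ}
    (hδ : 0 < δ) (hB : B.IsHermitian)
    (h : ∀ ξ : ι → ℂ, (star ξ ⬝ᵥ (A.mulVec ξ)).re + δ * (star ξ ⬝ᵥ ξ).re
      ≤ (star ξ ⬝ᵥ (B.mulVec ξ)).re) :
    A.det.re ^ ((Fintype.card ι : ℝ)⁻¹) + δ ≤ B.det.re ^ ((Fintype.card ι : ℝ)⁻¹) := by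
  set S := A + (δ : ℂ) • (1 : Matrix ι ι ℂ) with hSdef
  have h1 : ((δ : ℂ) • (1 : Matrix ι ι ℂ)).PosDef :=
    Matrix.PosDef.one.smul (by exact_mod_cast hδ)
  have hS : S.PosDef := Matrix.PosDef.posSemidef_add hA h1
  have hD : (B - S).PosSemidef := by
    refine Matrix.PosSemidef.of_dotProduct_mulVec_nonneg (hB.sub hS.1) fun ξ => ?_
    have him : (star ξ ⬝ᵥ ((B - S).mulVec ξ)).im = 0 :=
      (hB.sub hS.1).im_star_dotProduct_mulVec_self ξ
    rw [Complex.nonneg_iff]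
    refine ⟨?_, him.symm⟩
    have := h ξ
    simp only [hSdef, Matrix.sub_mulVec, Matrix.add_mulVec, Matrix.smul_mulVec, Matrix.one_mulVec,
      dotProduct_sub, dotProduct_add, dotProduct_smul, Complex.sub_re, Complex.add_re, smul_eq_mul,
      Complex.re_ofReal_mul]
    linarith
  have hle := det_le_det_add hS hD
  rw [add_sub_cancel] at hle
  have hle' := (Complex.le_def.mp hle).1
  rw [hSdef, det_add_smul_one hA.1, Complex.ofReal_re] at hle'
  have hAdet : A.det.re = ∏ i, hA.1.eigenvalues i := by
    have := det_add_smul_one hA.1 0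
    simp only [Complex.ofReal_zero, zero_smul, add_zero] at this
    rw [this, Complex.ofReal_re]
  rw [hAdet]
  refine (geom_mean_add_le _ hA.eigenvalues_nonneg hδ).trans ?_
  refine Real.rpow_le_rpow (Finset.prod_nonneg fun i _ => ?_) hle' (by positivity)
  have := hA.eigenvalues_nonneg i
  linarith

end MatrixDet

section Moebius

variable {V : Type*} [NormedAddCommGroup V]

/-- The factor `√(1 - ‖a‖²)` of the ball automorphism with parameter `a`. -/
noncomputable def moebiusScale (a : V) : ℝ := √(1 - ‖a‖ ^ 2)

theorem moebiusScale_pos {a : V} (ha : ‖a‖ < 1) : 0 < moebiusScale a := by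
  apply Real.sqrt_pos.mpr
  nlinarith [norm_nonneg a]

theorem moebiusScale_nonneg (a : V) : 0 ≤ moebiusScale a := Real.sqrt_nonneg _

theorem moebiusScale_sq {a : V} (ha : ‖a‖ < 1) : moebiusScale a ^ 2 = 1 - ‖a‖ ^ 2 := by
  apply Real.sq_sqrt
  nlinarith [norm_nonneg a]

theorem one_add_moebiusScale_ne_zero (a : V) : (1 + moebiusScale a : ℂ) ≠ 0 := by
  have := moebiusScale_nonneg a
  exact_mod_cast (by positivity : (0 : ℝ) < 1 + moebiusScale a).ne'

variable [InnerProductSpace ℂ V]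

/-- The denominator `1 - ⟪a, z⟫` of the ball automorphism with parameter `a`. -/
noncomputable def moebiusDenom (a z : V) : ℂ := 1 - inner ℂ a z

/-- The automorphism of the unit ball of a complex inner product space exchanging `0` and `a`. -/
noncomputable def moebius (a z : V) : V :=
  (moebiusDenom a z)⁻¹ • (a - (moebiusScale a : ℂ) • z
    - (inner ℂ a z * (1 + moebiusScale a : ℂ)⁻¹) • a)

/-- The numerator of the differential of `moebius a` at `z`. -/
noncomputable def moebiusDerivNum (a z ξ : V) : V :=
  -(moebiusDenom a z • ξ) + (inner ℂ a ξ : ℂ) • ((1 + moebiusScale a : ℂ)⁻¹ • a - z)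

/-- The differential of `moebius a` at `z`. -/
noncomputable def moebiusDeriv (a z ξ : V) : V :=
  ((moebiusScale a : ℂ) * (moebiusDenom a z ^ 2)⁻¹) • moebiusDerivNum a z ξ

theorem moebius_zero (a : V) : moebius a 0 = a := by
  simp [moebius, moebiusDenom]

theorem moebiusDenom_ne_zero {a z : V} (ha : ‖a‖ < 1) (hz : ‖z‖ ≤ 1) : moebiusDenom a z ≠ 0 := by
  intro h
  have h1 : (inner ℂ a z : ℂ) = 1 := (sub_eq_zero.mp h).symm
  have h2 := norm_inner_le_norm (𝕜 := ℂ) a z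
  rw [h1, norm_one] at h2
  nlinarith [norm_nonneg a, norm_nonneg z]

theorem one_sub_normSq_moebius {a z : V} (ha : ‖a‖ < 1) (hD : moebiusDenom a z ≠ 0) :
    (1 - ‖moebius a z‖ ^ 2) * ‖moebiusDenom a z‖ ^ 2
      = moebiusScale a ^ 2 * (1 - ‖z‖ ^ 2) := by
  have hs := moebiusScale_sq ha
  have hs0 := moebiusScale_nonneg a
  set s := moebiusScale a with hsdef
  set c : ℂ := inner ℂ a z with hc
  have hnum : ‖moebius a z‖ ^ 2 * ‖moebiusDenom a z‖ ^ 2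
      = ‖(1 - c * (1 + s : ℂ)⁻¹) • a - (s : ℂ) • z‖ ^ 2 := by
    rw [moebius, norm_smul, norm_inv, mul_pow, mul_right_comm, ← mul_pow,
      inv_mul_cancel₀ (norm_ne_zero_iff.mpr hD), one_pow, one_mul]
    congr 2
    rw [sub_smul, one_smul]
    abel
  have hexp : ‖(1 - c * (1 + s : ℂ)⁻¹) • a - (s : ℂ) • z‖ ^ 2
      = Complex.normSq (1 - c * (1 + s : ℂ)⁻¹) * ‖a‖ ^ 2
        - 2 * (starRingEnd ℂ (1 - c * (1 + s : ℂ)⁻¹) * s * c).re + s ^ 2 * ‖z‖ ^ 2 := by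
    rw [norm_sub_sq (𝕜 := ℂ), inner_smul_left, inner_smul_right, norm_smul, norm_smul, mul_pow,
      mul_pow, Complex.normSq_eq_norm_sq, Complex.norm_real, Real.norm_eq_abs, sq_abs, ← hc,
      mul_assoc]
    rfl
  have hinv : (1 + s : ℂ)⁻¹ = (((1 + s)⁻¹ : ℝ) : ℂ) := by push_cast; rfl
  have hDn : ‖moebiusDenom a z‖ ^ 2 = Complex.normSq (1 - c) := by
    rw [Complex.normSq_eq_norm_sq]; rfl
  rw [sub_mul, hnum, hexp, hDn, hinv]
  have ha2 : ‖a‖ ^ 2 = 1 - s ^ 2 := by linarith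
  rw [ha2]
  simp only [Complex.normSq_apply, Complex.sub_re, Complex.sub_im, Complex.mul_re, Complex.mul_im,
    Complex.one_re, Complex.one_im, Complex.ofReal_re, Complex.ofReal_im, map_sub, map_mul, map_one,
    Complex.conj_re, Complex.conj_im, Complex.conj_ofReal]
  have h1s : (1 + s) ≠ 0 := by positivity
  field_simp
  ring

theorem norm_moebius_lt_one {a z : V} (ha : ‖a‖ < 1) (hz : ‖z‖ < 1) : ‖moebius a z‖ < 1 := by
  have hD := moebiusDenom_ne_zero ha hz.le
  have h := one_sub_normSq_moebius ha hD
  have h1 : 0 < ‖moebiusDenom a z‖ ^ 2 := by positivity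
  have h2 : 0 < moebiusScale a ^ 2 * (1 - ‖z‖ ^ 2) :=
    mul_pos (pow_pos (moebiusScale_pos ha) 2) (by nlinarith [norm_nonneg z])
  rw [← h] at h2
  have h3 := pos_of_mul_pos_left h2 h1.le
  nlinarith [norm_nonneg (moebius a z)]

theorem norm_moebius_eq_one {a z : V} (ha : ‖a‖ < 1) (hz : ‖z‖ = 1) : ‖moebius a z‖ = 1 := by
  have hD := moebiusDenom_ne_zero ha hz.le
  have h := one_sub_normSq_moebius ha hD
  have h1 : ‖moebiusDenom a z‖ ^ 2 ≠ 0 := by positivity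
  rw [hz, one_pow, sub_self, mul_zero] at h
  have h2 := (mul_eq_zero.mp h).resolve_right h1
  have h3 : ‖moebius a z‖ ^ 2 = 1 := by linarith
  exact (pow_eq_one_iff_of_nonneg (norm_nonneg _) two_ne_zero).mp h3

theorem moebiusDenom_add_smul (a p ξ : V) (ζ : ℂ) :
    moebiusDenom a (p + ζ • ξ) = moebiusDenom a p - ζ * inner ℂ a ξ := by
  simp only [moebiusDenom, inner_add_right, inner_smul_right]
  ring

theorem moebiusDerivNum_add_smul (a p ξ : V) (ζ : ℂ) :
    moebiusDerivNum a (p + ζ • ξ) ξ = moebiusDerivNum a p ξ := by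
  simp only [moebiusDerivNum, moebiusDenom_add_smul]
  module

theorem hasDerivAt_moebiusDenom (a p ξ : V) (ζ : ℂ) :
    HasDerivAt (fun ζ : ℂ => moebiusDenom a (p + ζ • ξ)) (-(inner ℂ a ξ)) ζ := by
  simp_rw [moebiusDenom_add_smul]
  simpa using ((hasDerivAt_id ζ).mul_const (inner ℂ a ξ : ℂ)).const_sub (moebiusDenom a p)

theorem hasDerivAt_moebius {a p ξ : V} (ζ : ℂ) (hD : moebiusDenom a (p + ζ • ξ) ≠ 0) :
    HasDerivAt (fun ζ : ℂ => moebius a (p + ζ • ξ)) (moebiusDeriv a (p + ζ • ξ) ξ) ζ := by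
  have hs := one_add_moebiusScale_ne_zero a
  have h1 := (hasDerivAt_moebiusDenom a p ξ ζ).inv hD
  have hline : HasDerivAt (fun ζ : ℂ => p + ζ • ξ) ξ ζ := by
    simpa using ((hasDerivAt_id ζ).smul_const ξ).const_add p
  have h2 : HasDerivAt (fun ζ : ℂ => (inner ℂ a (p + ζ • ξ) * (1 + moebiusScale a : ℂ)⁻¹) • a)
      ((inner ℂ a ξ * (1 + moebiusScale a : ℂ)⁻¹) • a) ζ := by
    refine HasDerivAt.smul_const (HasDerivAt.mul_const ?_ _) a
    simpa [moebiusDenom] using (hasDerivAt_moebiusDenom a p ξ ζ).const_sub 1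
  have h3 := h1.smul (((hline.const_smul (moebiusScale a : ℂ)).const_sub a).sub h2)
  refine h3.congr_deriv ?_
  simp only [moebiusDeriv, moebiusDerivNum, Pi.inv_apply, Pi.sub_apply, Pi.smul_apply]
  generalize p + ζ • ξ = P at hD ⊢
  have hc : (inner ℂ a P : ℂ) = 1 - moebiusDenom a P := by
    simp [moebiusDenom]
  rw [hc]
  match_scalars <;> field_simp
  ring

theorem hasDerivAt_moebiusDeriv {a p ξ : V} (ζ : ℂ) (hD : moebiusDenom a (p + ζ • ξ) ≠ 0) :
    HasDerivAt (fun ζ : ℂ => moebiusDeriv a (p + ζ • ξ) ξ)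
      ((2 * moebiusScale a * inner ℂ a ξ * (moebiusDenom a (p + ζ • ξ) ^ 3)⁻¹) •
        moebiusDerivNum a p ξ) ζ := by
  simp only [moebiusDeriv, moebiusDerivNum_add_smul]
  refine HasDerivAt.smul_const ?_ _
  have h := (((hasDerivAt_moebiusDenom a p ξ ζ).pow 2).inv (pow_ne_zero 2 hD)).const_mul
    (moebiusScale a : ℂ)
  refine h.congr_deriv ?_
  simp only [Pi.pow_apply]
  field_simp
  ring

theorem moebiusDerivNum_smul (a p ξ : V) (c : ℂ) :
    moebiusDerivNum a p (c • ξ) = c • moebiusDerivNum a p ξ := by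
  simp only [moebiusDerivNum, inner_smul_right]
  module

theorem moebiusDeriv_smul (a p ξ : V) (c : ℂ) :
    moebiusDeriv a p (c • ξ) = c • moebiusDeriv a p ξ := by
  simp only [moebiusDeriv, moebiusDerivNum_smul]
  rw [smul_comm]

end Moebius

section MoebiusBounds

variable {V : Type*} [NormedAddCommGroup V] [InnerProductSpace ℂ V]

theorem contDiffAt_moebiusScale {a : V} (ha : ‖a‖ < 1) :
    ContDiffAt ℝ 1 (moebiusScale : V → ℝ) a := by
  let : InnerProductSpace ℝ V := InnerProductSpace.rclikeToReal ℂ V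
  unfold moebiusScale
  refine ContDiffAt.sqrt ?_ ?_
  · exact contDiffAt_const.sub (contDiff_norm_sq ℂ).contDiffAt
  · nlinarith [norm_nonneg a]

theorem contDiffAt_moebiusDenom (x : V × V × V) :
    ContDiffAt ℝ 1 (fun x : V × V × V => moebiusDenom x.1 x.2.1) x := by
  unfold moebiusDenom
  exact contDiffAt_const.sub (ContDiffAt.inner ℂ contDiffAt_fst contDiffAt_snd.fst)

theorem contDiffAt_moebiusScale_fst {x : V × V × V} (ha : ‖x.1‖ < 1) :
    ContDiffAt ℝ 1 (fun x : V × V × V => (moebiusScale x.1 : ℂ)) x :=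
  Complex.ofRealCLM.contDiff.contDiffAt.comp x
    ((contDiffAt_moebiusScale ha).comp x contDiffAt_fst)

theorem contDiffAt_inv_one_add_moebiusScale {x : V × V × V} (ha : ‖x.1‖ < 1) :
    ContDiffAt ℝ 1 (fun x : V × V × V => (1 + moebiusScale x.1 : ℂ)⁻¹) x :=
  (contDiffAt_const.add (contDiffAt_moebiusScale_fst ha)).inv (one_add_moebiusScale_ne_zero x.1)

theorem contDiffAt_moebius {x : V × V × V} (ha : ‖x.1‖ < 1) (hz : ‖x.2.1‖ ≤ 1) :
    ContDiffAt ℝ 1 (fun x : V × V × V => moebius x.1 x.2.1) x := by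
  unfold moebius
  refine ((contDiffAt_moebiusDenom x).inv (moebiusDenom_ne_zero ha hz)).smul
    ((contDiffAt_fst.sub ((contDiffAt_moebiusScale_fst ha).smul contDiffAt_snd.fst)).sub
    (((ContDiffAt.inner ℂ contDiffAt_fst contDiffAt_snd.fst).mul
      (contDiffAt_inv_one_add_moebiusScale ha)).smul contDiffAt_fst))

theorem contDiffAt_moebiusDeriv {x : V × V × V} (ha : ‖x.1‖ < 1) (hz : ‖x.2.1‖ ≤ 1) :
    ContDiffAt ℝ 1 (fun x : V × V × V => moebiusDeriv x.1 x.2.1 x.2.2) x := by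
  unfold moebiusDeriv moebiusDerivNum
  refine ((contDiffAt_moebiusScale_fst ha).mul (((contDiffAt_moebiusDenom x).pow 2).inv
    (pow_ne_zero 2 (moebiusDenom_ne_zero ha hz)))).smul
    (((contDiffAt_moebiusDenom x).smul contDiffAt_snd.snd).neg.add
      ((ContDiffAt.inner ℂ contDiffAt_fst contDiffAt_snd.snd).smul
        (((contDiffAt_inv_one_add_moebiusScale ha).smul contDiffAt_fst).sub contDiffAt_snd.fst)))

/-- The weight `|det (moebius a)'|^(2/n)`, where `e = 2(n+1)/n`. -/
noncomputable def moebiusWeight (e : ℝ) (a z : V) : ℝ :=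
  (moebiusScale a / ‖moebiusDenom a z‖) ^ e

theorem contDiffAt_moebiusWeight (e : ℝ) {x : V × V × V} (ha : ‖x.1‖ < 1) (hz : ‖x.2.1‖ ≤ 1) :
    ContDiffAt ℝ 1 (fun x : V × V × V => moebiusWeight e x.1 x.2.1) x := by
  unfold moebiusWeight
  have hD := moebiusDenom_ne_zero ha hz
  refine ContDiffAt.rpow_const_of_ne (ContDiffAt.div
    ((contDiffAt_moebiusScale ha).comp x contDiffAt_fst)
    ((contDiffAt_moebiusDenom x).norm ℂ hD) (norm_ne_zero_iff.mpr hD)) ?_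
  exact (div_pos (moebiusScale_pos ha) (norm_pos_iff.mpr hD)).ne'

/-- A function that is `C¹` near a product of balls is bounded there, and Lipschitz in the first
variable. -/
theorem exists_bound_of_contDiffAt [FiniteDimensional ℂ V]
    {W : Type*} [NormedAddCommGroup W] [NormedSpace ℝ W] {ρ : ℝ} (hρ : ρ < 1)
    (F : V × V × V → W)
    (hF : ∀ x : V × V × V, ‖x.1‖ < 1 → ‖x.2.1‖ ≤ 1 → ContDiffAt ℝ 1 F x) :
    ∃ M : ℝ, 1 ≤ M ∧ ∀ a b z ξ : V, ‖a‖ ≤ ρ → ‖b‖ ≤ ρ → ‖z‖ ≤ 1 → ‖ξ‖ ≤ 1 →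
      ‖F (a, z, ξ)‖ ≤ M ∧ ‖F (a, z, ξ) - F (b, z, ξ)‖ ≤ M * ‖a - b‖ := by
  have : ProperSpace V := FiniteDimensional.proper ℂ V
  set K : Set (V × V × V) := closedBall 0 ρ ×ˢ (closedBall 0 1 ×ˢ closedBall 0 1) with hK
  have hKc : IsCompact K := (isCompact_closedBall _ _).prod
    ((isCompact_closedBall _ _).prod (isCompact_closedBall _ _))
  have hKconv : Convex ℝ K := (convex_closedBall _ _).prod
    ((convex_closedBall _ _).prod (convex_closedBall _ _))
  have hFK : ContDiffOn ℝ 1 F K := fun x hx => by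
    simp only [hK, mem_prod, mem_closedBall, dist_zero_right] at hx
    exact (hF x (hx.1.trans_lt hρ) hx.2.1).contDiffWithinAt
  obtain ⟨L, hL⟩ := hFK.exists_lipschitzOnWith one_ne_zero hKconv hKc
  obtain ⟨B, hB⟩ := hKc.exists_bound_of_continuousOn hFK.continuousOn
  refine ⟨max 1 (max L B), le_max_left _ _, fun a b z ξ ha hb hz hξ => ?_⟩
  have h1 : ((a, z, ξ) : V × V × V) ∈ K := by simp [hK, ha, hz, hξ]
  have h2 : ((b, z, ξ) : V × V × V) ∈ K := by simp [hK, hb, hz, hξ]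
  refine ⟨(hB _ h1).trans (by simp), ?_⟩
  have h3 := hL.dist_le_mul _ h1 _ h2
  rw [dist_eq_norm] at h3
  refine h3.trans ?_
  rw [dist_eq_norm]
  simp only [Prod.mk_sub_mk, sub_self, Prod.norm_mk, norm_zero]
  rw [max_eq_left (by simp)]
  gcongr
  simp

theorem norm_le_of_smul_homogeneous {W : Type*} [NormedAddCommGroup W] [NormedSpace ℂ W]
    {T : V → W} (hT : ∀ (c : ℂ) ξ, T (c • ξ) = c • T ξ) {M : ℝ}
    (h : ∀ ξ, ‖ξ‖ ≤ 1 → ‖T ξ‖ ≤ M) (ξ : V) : ‖T ξ‖ ≤ M * ‖ξ‖ := by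
  rcases eq_or_ne ξ 0 with rfl | hξ
  · have := hT 0 0
    simp only [zero_smul] at this
    simp [this]
  have hn : 0 < ‖ξ‖ := norm_pos_iff.mpr hξ
  have h1 := h (((‖ξ‖⁻¹ : ℝ) : ℂ) • ξ) (by
    rw [norm_smul, Complex.norm_real, norm_inv, norm_norm, inv_mul_cancel₀ hn.ne'])
  rwa [hT, norm_smul, Complex.norm_real, norm_inv, norm_norm, inv_mul_le_iff₀ hn, mul_comm] at h1

theorem exists_moebius_bounds [FiniteDimensional ℂ V] (e : ℝ) {ρ : ℝ} (hρ : ρ < 1) :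
    ∃ M : ℝ, 1 ≤ M ∧ ∀ a b z : V, ‖a‖ ≤ ρ → ‖b‖ ≤ ρ → ‖z‖ ≤ 1 →
      ‖moebius a z - moebius b z‖ ≤ M * ‖a - b‖ ∧
      (∀ ξ, ‖moebiusDeriv a z ξ‖ ≤ M * ‖ξ‖) ∧
      (∀ ξ, ‖moebiusDeriv a z ξ - moebiusDeriv b z ξ‖ ≤ M * ‖a - b‖ * ‖ξ‖) ∧
      |moebiusWeight e a z| ≤ M ∧
      |moebiusWeight e a z - moebiusWeight e b z| ≤ M * ‖a - b‖ := by
  obtain ⟨M₁, h1, H1⟩ := exists_bound_of_contDiffAt (V := V) hρ _ fun x => contDiffAt_moebius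
  obtain ⟨M₂, h2, H2⟩ := exists_bound_of_contDiffAt (V := V) hρ _ fun x => contDiffAt_moebiusDeriv
  obtain ⟨M₃, h3, H3⟩ := exists_bound_of_contDiffAt (V := V) hρ _
    fun x => contDiffAt_moebiusWeight e
  refine ⟨max M₁ (max M₂ M₃), by simp [h1], fun a b z ha hb hz => ⟨?_, fun ξ => ?_, fun ξ => ?_,
    ?_, ?_⟩⟩
  · refine (H1 a b z 0 ha hb hz (by simp)).2.trans ?_
    gcongr; simp
  · refine (norm_le_of_smul_homogeneous (fun c ξ => moebiusDeriv_smul a z ξ c)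
      (fun ξ hξ => (H2 a b z ξ ha hb hz hξ).1) ξ).trans ?_
    gcongr; simp
  · refine (norm_le_of_smul_homogeneous (T := fun ξ => moebiusDeriv a z ξ - moebiusDeriv b z ξ)
      (fun c ξ => by simp only [moebiusDeriv_smul, smul_sub])
      (fun ξ hξ => (H2 a b z ξ ha hb hz hξ).2) ξ).trans ?_
    gcongr; simp
  · refine (H3 a b z 0 ha hb hz (by simp)).1.trans (by simp)
  · refine (H3 a b z 0 ha hb hz (by simp)).2.trans ?_
    gcongr; simp

end MoebiusBounds

section MoebiusMatrix

variable {n : ℕ}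

/-- The complex Jacobian matrix of `moebius a` at `z`. -/
noncomputable def moebiusJacobian (a z : EuclideanSpace ℂ (Fin n)) : Matrix (Fin n) (Fin n) ℂ :=
  (-(moebiusScale a * (moebiusDenom a z)⁻¹ : ℂ)) •
    (1 + Matrix.replicateCol Unit (WithLp.ofLp
        (-(moebiusDenom a z)⁻¹ • ((1 + moebiusScale a : ℂ)⁻¹ • a - z)))
      * Matrix.replicateRow Unit (star (WithLp.ofLp a)))

theorem moebiusJacobian_mulVec {a z : EuclideanSpace ℂ (Fin n)} (hD : moebiusDenom a z ≠ 0)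
    (ξ : EuclideanSpace ℂ (Fin n)) :
    (moebiusJacobian a z).mulVec (WithLp.ofLp ξ) = WithLp.ofLp (moebiusDeriv a z ξ) := by
  have h : (Matrix.replicateRow Unit (star (WithLp.ofLp a))).mulVec (WithLp.ofLp ξ)
      = fun _ => inner ℂ a ξ := by
    ext i
    rw [EuclideanSpace.inner_eq_star_dotProduct, dotProduct_comm]
    simp [Matrix.mulVec, Matrix.replicateRow, dotProduct]
  rw [moebiusJacobian, Matrix.smul_mulVec, Matrix.add_mulVec, Matrix.one_mulVec,
    ← Matrix.mulVec_mulVec, h]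
  ext i
  simp only [moebiusDeriv, moebiusDerivNum, Matrix.mulVec, Matrix.replicateCol, dotProduct,
    Matrix.of_apply, PiLp.smul_apply, PiLp.sub_apply, PiLp.add_apply, PiLp.neg_apply,
    Pi.smul_apply, Pi.add_apply, smul_eq_mul, Finset.univ_unique, Finset.sum_const,
    Finset.card_singleton, one_smul]
  have hs := one_add_moebiusScale_ne_zero a
  field_simp
  ring

theorem det_moebiusJacobian {a z : EuclideanSpace ℂ (Fin n)} (ha : ‖a‖ < 1)
    (hD : moebiusDenom a z ≠ 0) :
    ‖(moebiusJacobian a z).det‖ = (moebiusScale a / ‖moebiusDenom a z‖) ^ (n + 1) := by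
  have hs := one_add_moebiusScale_ne_zero a
  have hs2 : (‖a‖ : ℂ) ^ 2 = 1 - (moebiusScale a : ℂ) ^ 2 := by
    have := moebiusScale_sq ha
    exact_mod_cast (by linarith : ‖a‖ ^ 2 = 1 - moebiusScale a ^ 2)
  have hv : star (WithLp.ofLp a) ⬝ᵥ WithLp.ofLp
      (-(moebiusDenom a z)⁻¹ • ((1 + moebiusScale a : ℂ)⁻¹ • a - z))
      = inner ℂ a (-(moebiusDenom a z)⁻¹ • ((1 + moebiusScale a : ℂ)⁻¹ • a - z)) := by
    rw [EuclideanSpace.inner_eq_star_dotProduct, dotProduct_comm]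
  have hc : (inner ℂ a z : ℂ) = 1 - moebiusDenom a z := by simp [moebiusDenom]
  rw [moebiusJacobian, Matrix.det_smul, Matrix.det_one_add_replicateCol_mul_replicateRow, hv,
    inner_smul_right, inner_sub_right, inner_smul_right, inner_self_eq_norm_sq_to_K, hc]
  have hval : 1 + -(moebiusDenom a z)⁻¹ *
      ((1 + moebiusScale a : ℂ)⁻¹ * (‖a‖ : ℂ) ^ 2 - (1 - moebiusDenom a z))
      = moebiusScale a * (moebiusDenom a z)⁻¹ := by
    rw [hs2]
    field_simp
    ring
  erw [hval]
  rw [norm_mul, norm_pow, norm_neg, norm_mul, norm_inv, Complex.norm_real, Real.norm_eq_abs,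
    abs_of_nonneg (moebiusScale_nonneg a), Fintype.card_fin, pow_succ, div_eq_mul_inv]

end MoebiusMatrix

open Filter Topology

section SecondOrder

theorem second_deriv_nonpos_of_isLocalMax {h h' : ℝ → ℝ} {c : ℝ}
    (h1 : ∀ᶠ t in 𝓝 0, HasDerivAt h (h' t) t) (h2 : HasDerivAt h' c 0)
    (hmax : IsLocalMax h 0) : c ≤ 0 := by
  by_contra! hc
  have hd : deriv h =ᶠ[𝓝 0] h' := h1.mono fun t ht => ht.deriv
  have hdd : deriv (deriv h) 0 = c := by rw [hd.deriv_eq, h2.deriv]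
  have hmin : IsLocalMin h 0 := isLocalMin_of_deriv_deriv_pos (by rwa [hdd])
    hmax.deriv_eq_zero h1.self_of_nhds.continuousAt
  have hconst : h =ᶠ[𝓝 0] fun _ => h 0 := by
    filter_upwards [hmax, hmin] with t ht1 ht2 using le_antisymm ht1 ht2
  have h3 := hconst.deriv.deriv_eq
  simp only [deriv_const', hdd] at h3
  exact hc.ne' h3

theorem eventually_hasDerivAt_comp_curve {V : Type*} [NormedAddCommGroup V] [NormedSpace ℝ V]
    {u : V → ℝ} {γ γ' : ℝ → V} (hu : ContDiffAt ℝ 2 u (γ 0))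
    (hγ : ∀ᶠ t in 𝓝 0, HasDerivAt γ (γ' t) t) :
    ∀ᶠ t in 𝓝 0, HasDerivAt (fun t => u (γ t)) (fderiv ℝ u (γ t) (γ' t)) t := by
  have h1 : ∀ᶠ y in 𝓝 (γ 0), DifferentiableAt ℝ u y :=
    (hu.eventually (by simp)).mono fun y hy => hy.differentiableAt (by simp)
  filter_upwards [hγ, hγ.self_of_nhds.continuousAt.eventually h1] with t ht hut
  exact hut.hasFDerivAt.comp_hasDerivAt t ht

theorem hasDerivAt_fderiv_curve {V : Type*} [NormedAddCommGroup V] [NormedSpace ℝ V]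
    {u : V → ℝ} {γ γ' : ℝ → V} {γ'' : V} (hu : ContDiffAt ℝ 2 u (γ 0))
    (hγ : HasDerivAt γ (γ' 0) 0) (hγ' : HasDerivAt γ' γ'' 0) :
    HasDerivAt (fun t => fderiv ℝ u (γ t) (γ' t))
      (fderiv ℝ (fderiv ℝ u) (γ 0) (γ' 0) (γ' 0) + fderiv ℝ u (γ 0) γ'') 0 := by
  have h1 : DifferentiableAt ℝ (fderiv ℝ u) (γ 0) :=
    (hu.fderiv_right (m := 1) (by norm_num)).differentiableAt (by simp)
  exact (h1.hasFDerivAt.comp_hasDerivAt (0 : ℝ) hγ).clm_apply hγ'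

end SecondOrder

section Levi

variable {n : ℕ}

/-- The Levi form of `u` at `z`. -/
noncomputable def leviForm (u : EuclideanSpace ℂ (Fin n) → ℝ)
    (z η : EuclideanSpace ℂ (Fin n)) : ℝ :=
  (fderiv ℝ (fderiv ℝ u) z η η
    + fderiv ℝ (fderiv ℝ u) z (Complex.I • η) (Complex.I • η)) / 4

theorem euclidean_eq_sum_real (c : EuclideanSpace ℂ (Fin n)) :
    c = ∑ i, ((c i).re • EuclideanSpace.single i (1 : ℂ)
      + (c i).im • EuclideanSpace.single i Complex.I) := by
  ext j
  rw [WithLp.ofLp_sum, Finset.sum_apply, Finset.sum_eq_single j]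
  · simp
  · intro i _ hij
    simp [hij.symm]
  · simp

theorem bilin_sum_real (B : EuclideanSpace ℂ (Fin n) →L[ℝ] EuclideanSpace ℂ (Fin n) →L[ℝ] ℝ)
    (e f : Fin n → EuclideanSpace ℂ (Fin n)) (x y : Fin n → ℝ) :
    B (∑ i, (x i • e i + y i • f i)) (∑ i, (x i • e i + y i • f i))
      = ∑ i, ∑ j, (x j * (x i * B (e j) (e i) + y i * B (e j) (f i))
        + y j * (x i * B (f j) (e i) + y i * B (f j) (f i))) := by
  simp only [map_sum, sum_apply, map_add, add_apply, map_smul, smul_apply, smul_eq_mul]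
  refine Finset.sum_congr rfl fun i _ => ?_
  rw [Finset.mul_sum, Finset.mul_sum, ← Finset.sum_add_distrib]
  refine Finset.sum_congr rfl fun j _ => ?_
  ring

theorem leviForm_eq {u : EuclideanSpace ℂ (Fin n) → ℝ} {z : EuclideanSpace ℂ (Fin n)}
    (hu : ContDiffAt ℝ 2 u z) (η : EuclideanSpace ℂ (Fin n)) :
    leviForm u z η
      = (star (WithLp.ofLp η) ⬝ᵥ ((cxHessian n u z).transpose.mulVec (WithLp.ofLp η))).re := by
  have hd : DifferentiableAt ℝ (fderiv ℝ u) z :=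
    (hu.fderiv_right (m := 1) (by norm_num)).differentiableAt (by simp)
  set B := fderiv ℝ (fderiv ℝ u) z with hB
  have hf : ∀ v w : EuclideanSpace ℂ (Fin n), fderiv ℝ (fun w => fderiv ℝ u w v) z w = B w v := by
    intro v w
    have := (hd.hasFDerivAt.clm_apply (hasFDerivAt_const v z)).fderiv
    rw [this]
    simp [hB]
  have hIη : Complex.I • η = ∑ i, ((-(η i).im) • EuclideanSpace.single i (1 : ℂ)
      + (η i).re • EuclideanSpace.single i Complex.I) := by
    rw [euclidean_eq_sum_real (Complex.I • η)]
    simp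
  have hη := bilin_sum_real B (fun i => EuclideanSpace.single i (1 : ℂ))
    (fun i => EuclideanSpace.single i Complex.I) (fun i => (η i).re) (fun i => (η i).im)
  have hη' := bilin_sum_real B (fun i => EuclideanSpace.single i (1 : ℂ))
    (fun i => EuclideanSpace.single i Complex.I) (fun i => -(η i).im) (fun i => (η i).re)
  rw [← euclidean_eq_sum_real η] at hη
  rw [← hIη] at hη'
  rw [leviForm, ← hB, hη, hη']
  simp only [dotProduct, Matrix.mulVec, Matrix.transpose_apply, cxHessian, Matrix.of_apply, hf,
    Complex.re_sum, Finset.mul_sum, ← Finset.sum_add_distrib, Finset.sum_div]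
  refine Finset.sum_congr rfl fun i _ => Finset.sum_congr rfl fun j _ => ?_
  simp only [Pi.star_apply, Complex.star_def, Complex.mul_re, Complex.mul_im, Complex.conj_re,
    Complex.conj_im, Complex.add_re, Complex.add_im, Complex.ofReal_re, Complex.ofReal_im,
    Complex.I_re, Complex.I_im]
  norm_num
  ring

end Levi

section MaxPrinciple

variable {n : ℕ}

theorem moebius_line_second_deriv {u : EuclideanSpace ℂ (Fin n) → ℝ} {r : ℝ}
    {a p : EuclideanSpace ℂ (Fin n)} (ha : ‖a‖ < 1) (hp : ‖p‖ < 1)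
    (hu : ContDiffAt ℝ 2 u (r • moebius a p)) (ξ : EuclideanSpace ℂ (Fin n)) :
    ∃ h' : ℝ → ℝ,
      (∀ᶠ t : ℝ in 𝓝 0, HasDerivAt (fun t : ℝ => u (r • moebius a (p + (t : ℂ) • ξ))) (h' t) t) ∧
      HasDerivAt h' (r ^ 2 * fderiv ℝ (fderiv ℝ u) (r • moebius a p) (moebiusDeriv a p ξ)
          (moebiusDeriv a p ξ)
        + fderiv ℝ u (r • moebius a p) (r • (2 * moebiusScale a * inner ℂ a ξ *
          (moebiusDenom a p ^ 3)⁻¹ : ℂ) • moebiusDerivNum a p ξ)) 0 := by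
  have hD0 : moebiusDenom a p ≠ 0 := moebiusDenom_ne_zero ha hp.le
  have hDev : ∀ᶠ t : ℝ in 𝓝 0, moebiusDenom a (p + (t : ℂ) • ξ) ≠ 0 := by
    have hc : Continuous fun t : ℝ => moebiusDenom a (p + (t : ℂ) • ξ) := by
      simp only [moebiusDenom_add_smul]
      fun_prop
    exact hc.continuousAt.eventually_ne (by simpa using hD0)
  set γ : ℝ → EuclideanSpace ℂ (Fin n) := fun t => r • moebius a (p + (t : ℂ) • ξ) with hγdef
  set γ' : ℝ → EuclideanSpace ℂ (Fin n) := fun t => r • moebiusDeriv a (p + (t : ℂ) • ξ) ξ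
    with hγ'def
  have hγ0 : γ 0 = r • moebius a p := by simp [hγdef]
  have hγ'0 : γ' 0 = r • moebiusDeriv a p ξ := by simp [hγ'def]
  have hcast : ∀ t : ℝ, HasDerivAt (fun t : ℝ => (t : ℂ)) 1 t :=
    fun t => Complex.ofRealCLM.hasDerivAt
  have hγ : ∀ᶠ t in 𝓝 0, HasDerivAt γ (γ' t) t := by
    filter_upwards [hDev] with t ht
    have := (hasDerivAt_moebius (t : ℂ) ht).scomp t (hcast t)
    rw [one_smul] at this
    exact this.const_smul r
  have hγ' : HasDerivAt γ' (r • (2 * moebiusScale a * inner ℂ a ξ *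
          (moebiusDenom a p ^ 3)⁻¹ : ℂ) • moebiusDerivNum a p ξ) 0 := by
    have := (hasDerivAt_moebiusDeriv ((0 : ℝ) : ℂ) hDev.self_of_nhds).scomp 0 (hcast 0)
    rw [one_smul] at this
    refine HasDerivAt.congr_deriv (f := γ') (this.const_smul r) ?_
    simp
  have hu' : ContDiffAt ℝ 2 u (γ 0) := by rw [hγ0]; exact hu
  refine ⟨fun t => fderiv ℝ u (γ t) (γ' t), ?_, ?_⟩
  · exact eventually_hasDerivAt_comp_curve hu' hγ
  · have := hasDerivAt_fderiv_curve hu' hγ.self_of_nhds hγ'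
    refine this.congr_deriv ?_
    rw [hγ0, hγ'0]
    simp only [map_smul, smul_apply, smul_eq_mul]
    ring

theorem leviForm_le_of_isLocalMax {u : EuclideanSpace ℂ (Fin n) → ℝ} {r δ : ℝ}
    {a b p : EuclideanSpace ℂ (Fin n)} (ha : ‖a‖ < 1)
    (hb : ‖b‖ < 1) (hp : ‖p‖ < 1) (hua : ContDiffAt ℝ 2 u (r • moebius a p))
    (hub : ContDiffAt ℝ 2 u (r • moebius b p))
    (hmax : IsLocalMax (fun z => u (r • moebius a z) - u (r • moebius b z) + δ * ‖z‖ ^ 2) p)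
    (ξ : EuclideanSpace ℂ (Fin n)) :
    r ^ 2 * leviForm u (r • moebius a p) (moebiusDeriv a p ξ) + δ * ‖ξ‖ ^ 2
      ≤ r ^ 2 * leviForm u (r • moebius b p) (moebiusDeriv b p ξ) := by
  have key : ∀ ξ : EuclideanSpace ℂ (Fin n),
      (r ^ 2 * fderiv ℝ (fderiv ℝ u) (r • moebius a p) (moebiusDeriv a p ξ) (moebiusDeriv a p ξ)
        + fderiv ℝ u (r • moebius a p) (r • (2 * moebiusScale a * inner ℂ a ξ *
          (moebiusDenom a p ^ 3)⁻¹ : ℂ) • moebiusDerivNum a p ξ))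
      - (r ^ 2 * fderiv ℝ (fderiv ℝ u) (r • moebius b p) (moebiusDeriv b p ξ) (moebiusDeriv b p ξ)
        + fderiv ℝ u (r • moebius b p) (r • (2 * moebiusScale b * inner ℂ b ξ *
          (moebiusDenom b p ^ 3)⁻¹ : ℂ) • moebiusDerivNum b p ξ))
      + δ * (2 * ‖ξ‖ ^ 2) ≤ 0 := by
    intro ξ
    obtain ⟨ha', h1, h2⟩ := moebius_line_second_deriv ha hp hua ξ
    obtain ⟨hb', h3, h4⟩ := moebius_line_second_deriv hb hp hub ξ
    have hn : ∀ t : ℝ, ‖p + (t : ℂ) • ξ‖ ^ 2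
        = ‖p‖ ^ 2 + t * (2 * (inner ℂ p ξ : ℂ).re) + t ^ 2 * ‖ξ‖ ^ 2 := fun t => by
      rw [norm_add_sq (𝕜 := ℂ), inner_smul_right, norm_smul, mul_pow, Complex.norm_real,
        Real.norm_eq_abs, sq_abs, RCLike.re_eq_complex_re, Complex.re_ofReal_mul]
      ring
    have h5 : ∀ t : ℝ, HasDerivAt (fun t : ℝ => δ * ‖p + (t : ℂ) • ξ‖ ^ 2)
        (δ * (2 * (inner ℂ p ξ : ℂ).re + 2 * t * ‖ξ‖ ^ 2)) t := fun t => by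
      simp only [hn]
      refine HasDerivAt.const_mul δ ?_
      have e1 := (hasDerivAt_id t).mul_const (2 * (inner ℂ p ξ : ℂ).re)
      have e2 := (hasDerivAt_pow 2 t).mul_const (‖ξ‖ ^ 2)
      refine ((e1.const_add (‖p‖ ^ 2)).add e2).congr_deriv ?_
      simp
    have h6 : HasDerivAt (fun t : ℝ => δ * (2 * (inner ℂ p ξ : ℂ).re + 2 * t * ‖ξ‖ ^ 2))
        (δ * (2 * ‖ξ‖ ^ 2)) 0 := by
      refine HasDerivAt.const_mul δ ?_
      simpa using (((hasDerivAt_id (0 : ℝ)).const_mul 2).mul_const (‖ξ‖ ^ 2)).const_add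
        (2 * (inner ℂ p ξ : ℂ).re)
    refine second_deriv_nonpos_of_isLocalMax
      (h := fun t : ℝ => u (r • moebius a (p + (t : ℂ) • ξ)) - u (r • moebius b (p + (t : ℂ) • ξ))
        + δ * ‖p + (t : ℂ) • ξ‖ ^ 2) ?_ ((h2.sub h4).add h6) ?_
    · filter_upwards [h1, h3] with t e1 e2
      exact (e1.sub e2).add (h5 t)
    · have hcont : ContinuousAt (fun t : ℝ => p + (t : ℂ) • ξ) 0 := by fun_prop
      have h0 : p + ((0 : ℝ) : ℂ) • ξ = p := by simp
      have hmax' : IsLocalMax (fun z => u (r • moebius a z) - u (r • moebius b z) + δ * ‖z‖ ^ 2)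
          (p + ((0 : ℝ) : ℂ) • ξ) := by rwa [h0]
      refine (hcont.eventually hmax').mono fun t ht => ?_
      simpa using ht
  have k1 := key ξ
  have k2 := key (Complex.I • ξ)
  have hsecond : ∀ c : EuclideanSpace ℂ (Fin n),
      r • (2 * moebiusScale c * inner ℂ c (Complex.I • ξ) *
          (moebiusDenom c p ^ 3)⁻¹ : ℂ) • moebiusDerivNum c p (Complex.I • ξ)
      = -(r • (2 * moebiusScale c * inner ℂ c ξ *
          (moebiusDenom c p ^ 3)⁻¹ : ℂ) • moebiusDerivNum c p ξ) := fun c => by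
    rw [moebiusDerivNum_smul, inner_smul_right, smul_smul, ← smul_neg, ← neg_smul]
    congr 2
    linear_combination (2 * moebiusScale c * inner ℂ c ξ * (moebiusDenom c p ^ 3)⁻¹ : ℂ)
      * Complex.I_mul_I
  rw [hsecond a, hsecond b, map_neg, map_neg, moebiusDeriv_smul, moebiusDeriv_smul, norm_smul,
    Complex.norm_I, one_mul] at k2
  simp only [leviForm]
  linarith

end MaxPrinciple

section QuadraticForm

variable {n : ℕ}

theorem sum_norm_le_sqrt_mul_norm (ξ : EuclideanSpace ℂ (Fin n)) :
    ∑ i, ‖ξ i‖ ≤ √n * ‖ξ‖ := by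
  rw [EuclideanSpace.norm_eq, ← Real.sqrt_mul (by positivity)]
  refine Real.le_sqrt_of_sq_le ?_
  simpa using sq_sum_le_card_mul_sum_sq (s := Finset.univ) (f := fun i => ‖ξ i‖)

theorem norm_star_dotProduct_mulVec_le {A : Matrix (Fin n) (Fin n) ℂ} {K : ℝ} (hK : 0 ≤ K)
    (hA : ∀ i j, ‖A i j‖ ≤ K) (ξ η : EuclideanSpace ℂ (Fin n)) :
    ‖star (WithLp.ofLp ξ) ⬝ᵥ A.mulVec (WithLp.ofLp η)‖ ≤ n * K * ‖ξ‖ * ‖η‖ := by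
  calc ‖star (WithLp.ofLp ξ) ⬝ᵥ A.mulVec (WithLp.ofLp η)‖
      ≤ ∑ i, ‖ξ i‖ * ∑ j, K * ‖η j‖ := by
        simp only [dotProduct, Matrix.mulVec]
        refine (norm_sum_le _ _).trans (Finset.sum_le_sum fun i _ => ?_)
        rw [norm_mul, Pi.star_apply, norm_star]
        gcongr
        refine (norm_sum_le _ _).trans (Finset.sum_le_sum fun j _ => ?_)
        rw [norm_mul]
        gcongr
        exact hA i j
    _ = K * (∑ i, ‖ξ i‖) * ∑ j, ‖η j‖ := by rw [← Finset.sum_mul, ← Finset.mul_sum]; ring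
    _ ≤ K * (√n * ‖ξ‖) * (√n * ‖η‖) := by
        gcongr <;> exact sum_norm_le_sqrt_mul_norm _
    _ = n * K * ‖ξ‖ * ‖η‖ := by
        linear_combination (K * ‖ξ‖ * ‖η‖) * Real.mul_self_sqrt (Nat.cast_nonneg n)

theorem re_star_dotProduct_mulVec_sub_le {A B : Matrix (Fin n) (Fin n) ℂ} {K k N d : ℝ}
    (hK : 0 ≤ K) (hk : 0 ≤ k) (hN : 0 ≤ N) (hd : 0 ≤ d) (hA : ∀ i j, ‖A i j‖ ≤ K)
    (hAB : ∀ i j, ‖A i j - B i j‖ ≤ k) {ξ p q : EuclideanSpace ℂ (Fin n)}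
    (hp : ‖p‖ ≤ N * ‖ξ‖) (hq : ‖q‖ ≤ N * ‖ξ‖) (hpq : ‖p - q‖ ≤ d * ‖ξ‖) :
    (star (WithLp.ofLp p) ⬝ᵥ A.mulVec (WithLp.ofLp p)).re
      - (star (WithLp.ofLp q) ⬝ᵥ B.mulVec (WithLp.ofLp q)).re
      ≤ n * (2 * K * N * d + k * N ^ 2) * ‖ξ‖ ^ 2 := by
  have hsplit : star (WithLp.ofLp p) ⬝ᵥ A.mulVec (WithLp.ofLp p)
      - star (WithLp.ofLp q) ⬝ᵥ B.mulVec (WithLp.ofLp q)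
      = star (WithLp.ofLp p) ⬝ᵥ A.mulVec (WithLp.ofLp (p - q))
        + star (WithLp.ofLp (p - q)) ⬝ᵥ A.mulVec (WithLp.ofLp q)
        + star (WithLp.ofLp q) ⬝ᵥ (A - B).mulVec (WithLp.ofLp q) := by
    simp only [WithLp.ofLp_sub, Matrix.mulVec_sub, Matrix.sub_mulVec, dotProduct_sub, star_sub,
      sub_dotProduct]
    ring
  rw [← Complex.sub_re, hsplit]
  refine (Complex.re_le_norm _).trans ((norm_add₃_le).trans ?_)
  have h1 := norm_star_dotProduct_mulVec_le hK hA p (p - q)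
  have h2 := norm_star_dotProduct_mulVec_le hK hA (p - q) q
  have h3 := norm_star_dotProduct_mulVec_le (A := A - B) hk (by simpa using hAB) q q
  calc _ ≤ n * K * ‖p‖ * ‖p - q‖ + n * K * ‖p - q‖ * ‖q‖ + n * k * ‖q‖ * ‖q‖ := by gcongr
    _ ≤ n * K * (N * ‖ξ‖) * (d * ‖ξ‖) + n * K * (d * ‖ξ‖) * (N * ‖ξ‖)
        + n * k * (N * ‖ξ‖) * (N * ‖ξ‖) := by gcongr
    _ = _ := by ring

theorem re_star_dotProduct_self (ξ : EuclideanSpace ℂ (Fin n)) :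
    (star (WithLp.ofLp ξ) ⬝ᵥ WithLp.ofLp ξ).re = ‖ξ‖ ^ 2 := by
  rw [EuclideanSpace.norm_sq_eq]
  simp [dotProduct, Complex.normSq_eq_norm_sq, ← Complex.normSq_eq_conj_mul_self, -Complex.mul_re,
    -Complex.ofReal_pow]

theorem star_dotProduct_conjTranspose_mul (J A : Matrix (Fin n) (Fin n) ℂ) (ξ : Fin n → ℂ) :
    star ξ ⬝ᵥ (J.conjTranspose * A * J).mulVec ξ
      = star (J.mulVec ξ) ⬝ᵥ A.mulVec (J.mulVec ξ) := by
  rw [Matrix.star_mulVec, ← Matrix.mulVec_mulVec, ← Matrix.mulVec_mulVec,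
    Matrix.dotProduct_mulVec, Matrix.dotProduct_mulVec, Matrix.dotProduct_mulVec,
    Matrix.vecMul_vecMul, Matrix.vecMul_vecMul]

theorem det_re_conjTranspose_mul_rpow (J A : Matrix (Fin n) (Fin n) ℂ) {c : ℝ} (hc : 0 ≤ c)
    (hA : A.det = (c : ℂ)) :
    (J.conjTranspose * A.transpose * J).det.re ^ ((n : ℝ)⁻¹)
      = ‖J.det‖ ^ (2 * (n : ℝ)⁻¹) * c ^ ((n : ℝ)⁻¹) := by
  have : (J.conjTranspose * A.transpose * J).det = ((‖J.det‖ ^ 2 * c : ℝ) : ℂ) := by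
    rw [Matrix.det_mul, Matrix.det_mul, Matrix.det_conjTranspose, Matrix.det_transpose, hA]
    push_cast
    rw [← Complex.conj_mul', Complex.star_def]
    ring
  rw [this, Complex.ofReal_re, Real.mul_rpow (by positivity) hc, Real.rpow_mul (norm_nonneg _),
    Real.rpow_two]

theorem det_rpow_add_le_of_congr (hn : 0 < n) {Ga Gb Ha Hb Ja Jb : Matrix (Fin n) (Fin n) ℂ}
    {P Q : EuclideanSpace ℂ (Fin n) → EuclideanSpace ℂ (Fin n)}
    (hP : ∀ ξ, Ja.mulVec (WithLp.ofLp ξ) = WithLp.ofLp (P ξ))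
    (hQ : ∀ ξ, Jb.mulVec (WithLp.ofLp ξ) = WithLp.ofLp (Q ξ))
    (hA : (Ga + Ha).PosSemidef) (hB : (Gb + Hb).PosSemidef) {fa fb K k N d δ : ℝ}
    (hfa : 0 ≤ fa) (hfb : 0 ≤ fb) (hdA : (Ga + Ha).det = (fa : ℂ)) (hdB : (Gb + Hb).det = (fb : ℂ))
    (hK : 0 ≤ K) (hk : 0 ≤ k) (hN : 0 ≤ N) (hd : 0 ≤ d) (hGa : ∀ i j, ‖Ga i j‖ ≤ K)
    (hGab : ∀ i j, ‖Ga i j - Gb i j‖ ≤ k)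
    (hPN : ∀ ξ, ‖P ξ‖ ≤ N * ‖ξ‖) (hQN : ∀ ξ, ‖Q ξ‖ ≤ N * ‖ξ‖)
    (hPQ : ∀ ξ, ‖P ξ - Q ξ‖ ≤ d * ‖ξ‖)
    (h : ∀ ξ, (star (WithLp.ofLp (P ξ)) ⬝ᵥ Ha.transpose.mulVec (WithLp.ofLp (P ξ))).re
        + δ * ‖ξ‖ ^ 2
      ≤ (star (WithLp.ofLp (Q ξ)) ⬝ᵥ Hb.transpose.mulVec (WithLp.ofLp (Q ξ))).re)
    (hδ : n * (2 * K * N * d + k * N ^ 2) < δ) :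
    ‖Ja.det‖ ^ (2 * (n : ℝ)⁻¹) * fa ^ ((n : ℝ)⁻¹) + (δ - n * (2 * K * N * d + k * N ^ 2))
      ≤ ‖Jb.det‖ ^ (2 * (n : ℝ)⁻¹) * fb ^ ((n : ℝ)⁻¹) := by
  have : Nonempty (Fin n) := ⟨⟨0, hn⟩⟩
  rw [← det_re_conjTranspose_mul_rpow Ja _ hfa hdA, ← det_re_conjTranspose_mul_rpow Jb _ hfb hdB]
  have hmain := det_rpow_add_le (A := Ja.conjTranspose * (Ga + Ha).transpose * Ja)
    (B := Jb.conjTranspose * (Gb + Hb).transpose * Jb)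
    (hA.transpose.conjTranspose_mul_mul_same Ja) (sub_pos.mpr hδ)
    (hB.transpose.conjTranspose_mul_mul_same Jb).isHermitian fun ξ => ?_
  · simpa using hmain
  · obtain ⟨ξ, rfl⟩ : ∃ ξ' : EuclideanSpace ℂ (Fin n), ξ = WithLp.ofLp ξ' := ⟨WithLp.toLp 2 ξ, rfl⟩
    have hG := re_star_dotProduct_mulVec_sub_le (A := Ga.transpose) (B := Gb.transpose) (ξ := ξ)
      hK hk hN hd (fun i j => hGa j i) (fun i j => hGab j i) (hPN ξ) (hQN ξ) (hPQ ξ)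
    rw [star_dotProduct_conjTranspose_mul, star_dotProduct_conjTranspose_mul, hP, hQ,
      re_star_dotProduct_self, Matrix.transpose_add, Matrix.transpose_add, Matrix.add_mulVec,
      Matrix.add_mulVec, dotProduct_add, dotProduct_add, Complex.add_re, Complex.add_re]
    linarith [h ξ]

end QuadraticForm

section Estimate

variable {n : ℕ}

theorem norm_det_moebiusJacobian_rpow {a z : EuclideanSpace ℂ (Fin n)} (ha : ‖a‖ < 1)
    (hz : ‖z‖ ≤ 1) (s : ℝ) :
    ‖(moebiusJacobian a z).det‖ ^ s = moebiusWeight (((n + 1 : ℕ) : ℝ) * s) a z := by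
  have h0 : 0 ≤ moebiusScale a / ‖moebiusDenom a z‖ :=
    div_nonneg (moebiusScale_nonneg a) (norm_nonneg _)
  rw [det_moebiusJacobian ha (moebiusDenom_ne_zero ha hz), moebiusWeight, Real.rpow_mul h0,
    Real.rpow_natCast]

theorem smul_moebius_mem_ball {r : ℝ} (hr : 0 < r) {a z : EuclideanSpace ℂ (Fin n)}
    (ha : ‖a‖ < 1) (hz : ‖z‖ < 1) : r • moebius a z ∈ ball (0 : EuclideanSpace ℂ (Fin n)) r := by
  rw [mem_ball_zero_iff, norm_smul, Real.norm_of_nonneg hr.le]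
  exact mul_lt_of_lt_one_right hr (norm_moebius_lt_one ha hz)

theorem smul_moebius_mem_sphere {r : ℝ} (hr : 0 < r) {a z : EuclideanSpace ℂ (Fin n)}
    (ha : ‖a‖ < 1) (hz : ‖z‖ = 1) : r • moebius a z ∈ sphere (0 : EuclideanSpace ℂ (Fin n)) r := by
  rw [mem_sphere_zero_iff_norm, norm_smul, Real.norm_of_nonneg hr.le, norm_moebius_eq_one ha hz,
    mul_one]

theorem norm_smul_moebius_sub_rpow_le {r M α : ℝ} (hr : 0 < r) (hα : 0 < α)
    {a b z : EuclideanSpace ℂ (Fin n)} (h : ‖moebius a z - moebius b z‖ ≤ M * ‖a - b‖) :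
    ‖r • moebius a z - r • moebius b z‖ ^ α ≤ (r * (M * ‖a - b‖)) ^ α := by
  rw [← smul_sub, norm_smul, Real.norm_of_nonneg hr.le]
  gcongr

theorem le_of_isLocalMax_moebius (hn : 0 < n) {ρ M : ℝ} (hρ : ρ < 1) (hM : 1 ≤ M)
    (HM : ∀ a b z : EuclideanSpace ℂ (Fin n), ‖a‖ ≤ ρ → ‖b‖ ≤ ρ → ‖z‖ ≤ 1 →
      ‖moebius a z - moebius b z‖ ≤ M * ‖a - b‖ ∧
      (∀ ξ, ‖moebiusDeriv a z ξ‖ ≤ M * ‖ξ‖) ∧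
      (∀ ξ, ‖moebiusDeriv a z ξ - moebiusDeriv b z ξ‖ ≤ M * ‖a - b‖ * ‖ξ‖) ∧
      |moebiusWeight (((n + 1 : ℕ) : ℝ) * (2 * (n : ℝ)⁻¹)) a z| ≤ M ∧
      |moebiusWeight (((n + 1 : ℕ) : ℝ) * (2 * (n : ℝ)⁻¹)) a z
        - moebiusWeight (((n + 1 : ℕ) : ℝ) * (2 * (n : ℝ)⁻¹)) b z| ≤ M * ‖a - b‖)
    {α r : ℝ} (hα : 0 < α) (hr : 0 < r) {u f g : EuclideanSpace ℂ (Fin n) → ℝ}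
    {G : EuclideanSpace ℂ (Fin n) → Matrix (Fin n) (Fin n) ℂ}
    (hu : ContDiffOn ℝ 2 u (ball 0 r))
    (hpsd : ∀ z ∈ ball (0 : EuclideanSpace ℂ (Fin n)) r, (G z + cxHessian n u z).PosSemidef)
    (hdet : ∀ z ∈ ball (0 : EuclideanSpace ℂ (Fin n)) r,
      (G z + cxHessian n u z).det = (f z : ℂ))
    (hf : ∀ z ∈ closedBall (0 : EuclideanSpace ℂ (Fin n)) r, 0 ≤ f z)
    (hg : ∀ z ∈ closedBall (0 : EuclideanSpace ℂ (Fin n)) r, g z = f z ^ ((n : ℝ)⁻¹))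
    {K₀ K₁ Kg₀ Kg₁ : ℝ} (hKg₀ : 0 ≤ Kg₀) (hK₁ : 0 ≤ K₁) (hKg₁ : 0 ≤ Kg₁)
    (hgK₀ : ∀ x ∈ ball (0 : EuclideanSpace ℂ (Fin n)) r, |g x| ≤ K₀)
    (hgK₁ : ∀ x ∈ ball (0 : EuclideanSpace ℂ (Fin n)) r,
      ∀ y ∈ ball (0 : EuclideanSpace ℂ (Fin n)) r, |g x - g y| ≤ K₁ * ‖x - y‖ ^ α)
    (hGK₀ : ∀ i j : Fin n, ∀ x ∈ ball (0 : EuclideanSpace ℂ (Fin n)) r, ‖G x i j‖ ≤ Kg₀)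
    (hGK₁ : ∀ i j : Fin n, ∀ x ∈ ball (0 : EuclideanSpace ℂ (Fin n)) r,
      ∀ y ∈ ball (0 : EuclideanSpace ℂ (Fin n)) r,
        ‖G x i j - G y i j‖ ≤ Kg₁ * ‖x - y‖ ^ α)
    {a b p : EuclideanSpace ℂ (Fin n)} {δ : ℝ} (ha : ‖a‖ ≤ ρ) (hb : ‖b‖ ≤ ρ) (hp : ‖p‖ < 1)
    (hmax : IsLocalMax (fun z => u (r • moebius a z) - u (r • moebius b z) + δ * ‖z‖ ^ 2) p) :
    δ ≤ r ^ 2 * (n * (2 * Kg₀ * M * (M * ‖a - b‖) + Kg₁ * (r * (M * ‖a - b‖)) ^ α * M ^ 2)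
      + M * ‖a - b‖ * K₀ + M * (K₁ * (r * (M * ‖a - b‖)) ^ α)) := by
  have ha1 := ha.trans_lt hρ
  have hb1 := hb.trans_lt hρ
  have hM0 : 0 ≤ M := zero_le_one.trans hM
  have hxa := smul_moebius_mem_ball hr ha1 hp
  have hxb := smul_moebius_mem_ball hr hb1 hp
  obtain ⟨H1, H2, H3, H4, H5⟩ := HM a b p ha hb hp.le
  have H2' := (HM b a p hb ha hp.le).2.1
  have H4' := (HM b a p hb ha hp.le).2.2.2.1
  have hdist := norm_smul_moebius_sub_rpow_le hr hα H1
  have hua := hu.contDiffAt (isOpen_ball.mem_nhds hxa)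
  have hub := hu.contDiffAt (isOpen_ball.mem_nhds hxb)
  have hL := leviForm_le_of_isLocalMax ha1 hb1 hp hua hub hmax
  set s := (r * (M * ‖a - b‖)) ^ α with hs
  have hs0 : 0 ≤ s := by positivity
  have hK₀ : 0 ≤ K₀ := (abs_nonneg _).trans (hgK₀ _ hxa)
  set xa := r • moebius a p
  set xb := r • moebius b p
  rw [← div_le_iff₀' (by positivity)]
  rcases le_or_gt (δ / r ^ 2) (n * (2 * Kg₀ * M * (M * ‖a - b‖) + Kg₁ * s * M ^ 2)) with hδ | hδ
  · have : 0 ≤ M * ‖a - b‖ * K₀ + M * (K₁ * s) := by positivity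
    linarith
  have hdetle := det_rpow_add_le_of_congr hn
    (moebiusJacobian_mulVec (moebiusDenom_ne_zero ha1 hp.le))
    (moebiusJacobian_mulVec (moebiusDenom_ne_zero hb1 hp.le)) (hpsd xa hxa) (hpsd xb hxb)
    (hf _ (ball_subset_closedBall hxa)) (hf _ (ball_subset_closedBall hxb)) (hdet xa hxa)
    (hdet xb hxb) hKg₀ (by positivity) hM0 (by positivity) (fun i j => hGK₀ i j xa hxa)
    (fun i j => (hGK₁ i j xa hxa xb hxb).trans (mul_le_mul_of_nonneg_left hdist hKg₁)) H2 H2' H3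
    (fun ξ => by
      rw [← leviForm_eq hua, ← leviForm_eq hub]
      have h1 := hL ξ
      have h2 : 0 < r ^ 2 := by positivity
      refine le_of_mul_le_mul_left ?_ h2
      calc _ = r ^ 2 * leviForm u xa (moebiusDeriv a p ξ) + δ * ‖ξ‖ ^ 2 := by field_simp
        _ ≤ _ := h1) hδ
  rw [norm_det_moebiusJacobian_rpow ha1 hp.le, norm_det_moebiusJacobian_rpow hb1 hp.le,
    ← hg _ (ball_subset_closedBall hxa), ← hg _ (ball_subset_closedBall hxb)] at hdetle
  set qa := moebiusWeight (((n + 1 : ℕ) : ℝ) * (2 * (n : ℝ)⁻¹)) a p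
  set qb := moebiusWeight (((n + 1 : ℕ) : ℝ) * (2 * (n : ℝ)⁻¹)) b p
  have e1 : (qb - qa) * g xa ≤ M * ‖a - b‖ * K₀ := by
    refine (le_abs_self _).trans ?_
    rw [abs_mul, abs_sub_comm]
    exact mul_le_mul H5 (hgK₀ _ hxa) (abs_nonneg _) (by positivity)
  have e2 : qb * (g xb - g xa) ≤ M * (K₁ * s) := by
    refine (le_abs_self _).trans ?_
    rw [abs_mul, abs_sub_comm (g xb)]
    exact mul_le_mul H4' ((hgK₁ _ hxa _ hxb).trans (mul_le_mul_of_nonneg_left hdist hK₁))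
      (abs_nonneg _) hM0
  linarith

theorem continuousOn_comp_smul_moebius {r : ℝ} (hr : 0 < r) {u : EuclideanSpace ℂ (Fin n) → ℝ}
    (hu : ContinuousOn u (closedBall 0 r)) {a : EuclideanSpace ℂ (Fin n)} (ha : ‖a‖ < 1) :
    ContinuousOn (fun z => u (r • moebius a z)) (closedBall 0 1) := by
  refine hu.comp (fun z hz => ContinuousAt.continuousWithinAt ?_) fun z hz => ?_
  · rw [mem_closedBall_zero_iff] at hz
    have h1 := (contDiffAt_moebius (x := (a, z, (0 : EuclideanSpace ℂ (Fin n)))) ha hz).continuousAt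
    have h2 : ContinuousAt (fun z : EuclideanSpace ℂ (Fin n) =>
      (a, z, (0 : EuclideanSpace ℂ (Fin n)))) z := by fun_prop
    exact (ContinuousAt.comp (f := fun z : EuclideanSpace ℂ (Fin n) =>
      (a, z, (0 : EuclideanSpace ℂ (Fin n)))) h1 h2).const_smul r
  · rw [mem_closedBall_zero_iff] at hz
    rcases hz.lt_or_eq with h | h
    · exact ball_subset_closedBall (smul_moebius_mem_ball hr ha h)
    · exact sphere_subset_closedBall (smul_moebius_mem_sphere hr ha h)

/-- The comparison of two pullbacks of `u` by ball automorphisms. -/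
theorem sub_le_of_forall_isLocalMax {ρ M : ℝ} (hρ : ρ < 1)
    (HM : ∀ a b z : EuclideanSpace ℂ (Fin n), ‖a‖ ≤ ρ → ‖b‖ ≤ ρ → ‖z‖ ≤ 1 →
      ‖moebius a z - moebius b z‖ ≤ M * ‖a - b‖)
    {α r : ℝ} (hα : 0 < α) (hr : 0 < r) {u : EuclideanSpace ℂ (Fin n) → ℝ}
    (hu : ContinuousOn u (closedBall 0 r)) {K : ℝ} (hK : 0 ≤ K)
    (hφ : ∀ x ∈ sphere (0 : EuclideanSpace ℂ (Fin n)) r,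
        ∀ y ∈ sphere (0 : EuclideanSpace ℂ (Fin n)) r, |u x - u y| ≤ K * ‖x - y‖ ^ α)
    {a b : EuclideanSpace ℂ (Fin n)} {δ₀ : ℝ} (ha : ‖a‖ ≤ ρ) (hb : ‖b‖ ≤ ρ)
    (hδ₀ : ∀ δ p, ‖p‖ < 1 →
      IsLocalMax (fun z => u (r • moebius a z) - u (r • moebius b z) + δ * ‖z‖ ^ 2) p → δ ≤ δ₀) :
    u (r • a) - u (r • b) ≤ K * (r * (M * ‖a - b‖)) ^ α + δ₀ := by
  have ha1 := ha.trans_lt hρ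
  have hb1 := hb.trans_lt hρ
  refine le_of_forall_gt_imp_ge_of_dense fun c hc => ?_
  set δ := c - K * (r * (M * ‖a - b‖)) ^ α with hδ
  obtain ⟨p, hp, hpmax⟩ := (isCompact_closedBall (0 : EuclideanSpace ℂ (Fin n)) 1).exists_isMaxOn
    ⟨0, by simp⟩ (((continuousOn_comp_smul_moebius hr hu ha1).sub
      (continuousOn_comp_smul_moebius hr hu hb1)).add
      (f := fun z => u (r • moebius a z) - u (r • moebius b z)) (g := fun z => δ * ‖z‖ ^ 2)
      (by fun_prop))
  have h0 := hpmax (show (0 : EuclideanSpace ℂ (Fin n)) ∈ closedBall 0 1 by simp)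
  simp only [mem_ofPred_eq, Pi.add_apply, moebius_zero, norm_zero] at h0
  rw [mem_closedBall_zero_iff] at hp
  rcases hp.lt_or_eq with h | h
  · have := hδ₀ δ p h (hpmax.isLocalMax (closedBall_mem_nhds_of_mem (by simpa using h)))
    linarith
  · have h1 := hφ _ (smul_moebius_mem_sphere hr ha1 h) _ (smul_moebius_mem_sphere hr hb1 h)
    have h2 := norm_smul_moebius_sub_rpow_le hr hα (HM a b p ha hb hp)
    have h3 := (le_abs_self _).trans (h1.trans (mul_le_mul_of_nonneg_left h2 hK))
    rw [h] at h0
    linarith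

end Estimate

section Constants

variable {n : ℕ}

theorem nonneg_of_nonneg_le_mul_rpow {K c d α : ℝ} (hc : 0 ≤ c) (hd : 0 < d)
    (h : c ≤ K * d ^ α) : 0 ≤ K :=
  nonneg_of_mul_nonneg_left (hc.trans h) (Real.rpow_pos_of_pos hd α)

theorem exists_ne_mem_ball (hn : 0 < n) {r : ℝ} (hr : 0 < r) :
    ∃ x ∈ ball (0 : EuclideanSpace ℂ (Fin n)) r, ∃ y ∈ ball (0 : EuclideanSpace ℂ (Fin n)) r,
      0 < ‖x - y‖ := by
  refine ⟨EuclideanSpace.single ⟨0, hn⟩ ((r / 2 : ℝ) : ℂ), ?_, 0, by simpa using hr, ?_⟩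
  · rw [mem_ball_zero_iff, PiLp.norm_single, Complex.norm_of_nonneg (by positivity)]
    linarith
  · rw [sub_zero, PiLp.norm_single, Complex.norm_of_nonneg (by positivity)]
    positivity

theorem exists_ne_mem_sphere (hn : 0 < n) {r : ℝ} (hr : 0 < r) :
    ∃ x ∈ sphere (0 : EuclideanSpace ℂ (Fin n)) r, ∃ y ∈ sphere (0 : EuclideanSpace ℂ (Fin n)) r,
      0 < ‖x - y‖ := by
  have h : ‖(EuclideanSpace.single ⟨0, hn⟩ (r : ℂ) : EuclideanSpace ℂ (Fin n))‖ = r := by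
    rw [PiLp.norm_single, Complex.norm_of_nonneg hr.le]
  refine ⟨EuclideanSpace.single ⟨0, hn⟩ (r : ℂ), by simpa using h,
    -EuclideanSpace.single ⟨0, hn⟩ (r : ℂ), by simpa using h, ?_⟩
  rw [sub_neg_eq_add, ← two_smul ℝ, norm_smul, h]
  exact mul_pos (by norm_num) hr

theorem le_two_mul_rpow {d α : ℝ} (hd : 0 ≤ d) (hd2 : d ≤ 2) (hα : 0 < α) (hα1 : α ≤ 1) :
    d ≤ 2 * d ^ α := by
  calc d = d ^ (α + (1 - α)) := by simp
    _ = d ^ α * d ^ (1 - α) := Real.rpow_add_of_nonneg hd hα.le (by linarith)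
    _ ≤ d ^ α * 2 := by
        gcongr
        calc d ^ (1 - α) ≤ 2 ^ (1 - α) := by gcongr
          _ ≤ 2 ^ (1 : ℝ) := by gcongr <;> linarith
          _ = 2 := Real.rpow_one 2
    _ = 2 * d ^ α := mul_comm _ _

theorem estimate_combine (hn : 0 < n) {r M α d K K₀ K₁ L₀ L₁ : ℝ} (hr : 0 < r) (hM : 1 ≤ M)
    (hα : 0 < α) (hα1 : α ≤ 1) (hd : 0 ≤ d) (hd2 : d ≤ 2) (hK : 0 ≤ K) (hK₀ : 0 ≤ K₀)
    (hK₁ : 0 ≤ K₁) (hL₀ : 0 ≤ L₀) (hL₁ : 0 ≤ L₁) :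
    K * (r * (M * d)) ^ α + r ^ 2 * (n * (2 * L₀ * M * (M * d) + L₁ * (r * (M * d)) ^ α * M ^ 2)
        + M * d * K₀ + M * (K₁ * (r * (M * d)) ^ α))
      ≤ 4 * n * M ^ 3 * (K + r ^ (2 - α) * (K₀ + r ^ α * K₁) + r ^ (2 - α) * (L₀ + r ^ α * L₁))
        * (r * d) ^ α := by
  have hM0 : 0 ≤ M := zero_le_one.trans hM
  have hn1 : (1 : ℝ) ≤ n := by exact_mod_cast hn
  have hMα : M ^ α ≤ M := by
    simpa using Real.rpow_le_rpow_of_exponent_le hM hα1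
  have hd' := le_two_mul_rpow hd hd2 hα hα1
  have hr2 : r ^ (2 - α) * r ^ α = r ^ 2 := by
    rw [← Real.rpow_add hr]; simp
  rw [Real.mul_rpow hr.le (by positivity), Real.mul_rpow hM0 hd, Real.mul_rpow hr.le hd]
  set τ := d ^ α
  set R := r ^ α
  have hτ : 0 ≤ τ := by positivity
  have hR : 0 ≤ R := by positivity
  have hM12 : M ≤ M ^ 2 := by nlinarith
  have hM23 : M ^ 2 ≤ M ^ 3 := by nlinarith [sq_nonneg M]
  have hM13 : M ≤ M ^ 3 := hM12.trans hM23
  have hnM : M ^ 3 ≤ n * M ^ 3 := le_mul_of_one_le_left (by positivity) hn1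
  calc _ ≤ K * (R * (M * τ)) + r ^ 2 * (n * (2 * L₀ * M * (M * (2 * τ))
        + L₁ * (R * (M * τ)) * M ^ 2) + M * (2 * τ) * K₀ + M * (K₁ * (R * (M * τ)))) := by gcongr
    _ = M * (K * R * τ) + r ^ 2 * (n * (4 * M ^ 2 * (L₀ * τ) + M ^ 3 * (L₁ * R * τ))
        + 2 * M * (K₀ * τ) + M ^ 2 * (K₁ * R * τ)) := by ring
    _ ≤ (4 * n * M ^ 3) * (K * R * τ) + r ^ 2 * (n * (4 * M ^ 3 * (L₀ * τ)
        + (4 * M ^ 3) * (L₁ * R * τ)) + (4 * n * M ^ 3) * (K₀ * τ)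
        + (4 * n * M ^ 3) * (K₁ * R * τ)) := by
        have hn3 : 0 ≤ n * M ^ 3 := by positivity
        have hM3 : 0 ≤ M ^ 3 := by positivity
        gcongr <;> linarith
    _ = 4 * n * M ^ 3 * (K * R * τ + r ^ 2 * ((K₀ + R * K₁) * τ)
        + r ^ 2 * ((L₀ + R * L₁) * τ)) := by ring
    _ = _ := by rw [← hr2]; ring

end Constants

end InteriorHolder

/-- **Interior Hölder estimate for the complex Monge–Ampère equation with a Hermitian
background form** (Theorem 5.1, case i = 0). Let `ω = i ∑ g_{i j̄} dz_i ∧ dz̄_j` be a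
Hermitian form on `B̄_r(0) ⊂ ℂⁿ` (so `G z = (g_{i j̄}(z))` is positive definite
Hermitian) with entries in `C^{0,α}(B̄_r(0))`. If `u ∈ PSH(B_r(0), ω) ∩ C(B̄_r(0))`
solves `det(g_{i j̄} + u_{i j̄}) = f` in `B_r(0)`, `u = φ` on `∂B_r(0)`, with
`φ ∈ C^{0,α}(∂B_r(0))`, `f ≥ 0`, `f^{1/n} ∈ C^{0,α}(B̄_r(0))`, `α ∈ (0,1]`, then for
every `t ∈ (0,1)`:
`[u]_{0,α;B_{(1-t)r}} ≤ C(n,t)([φ]_{0,α;∂B_r} + r^{2-α}|f^{1/n}|'_{0,α;B_r} + r^{2-α}|g|'_{0,α;B_r})`.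
Sup-type seminorms are expressed through arbitrary upper bounds `Kφ, K₀, K₁`
(for `φ` and `f^{1/n}`) and `Kg₀, Kg₁` (uniform over all entries of `g`). -/
theorem interior_C0alpha_estimate_hermitian (n : ℕ) (hn : 0 < n)
    (t : ℝ) (ht0 : 0 < t) (ht1 : t < 1) :
    ∃ C : ℝ, ∀ (α : ℝ), 0 < α → α ≤ 1 → ∀ (r : ℝ), 0 < r →
      ∀ u f g φ : EuclideanSpace ℂ (Fin n) → ℝ,
      ∀ G : EuclideanSpace ℂ (Fin n) → Matrix (Fin n) (Fin n) ℂ,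
      -- G is positive definite Hermitian on B̄_r with entries continuous on B̄_r
      (∀ z ∈ closedBall (0 : EuclideanSpace ℂ (Fin n)) r, (G z).PosDef) →
      (∀ i j : Fin n, ContinuousOn (fun z => G z i j) (closedBall 0 r)) →
      -- u ∈ C²(B_r) ∩ C(B̄_r)
      ContDiffOn ℝ 2 u (ball 0 r) →
      ContinuousOn u (closedBall 0 r) →
      -- (g_{i j̄} + u_{i j̄}) is positive semidefinite on B_r
      (∀ z ∈ ball (0 : EuclideanSpace ℂ (Fin n)) r, (G z + cxHessian n u z).PosSemidef) →
      -- the equation det(g_{i j̄} + u_{i j̄}) = f in B_r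
      (∀ z ∈ ball (0 : EuclideanSpace ℂ (Fin n)) r, (G z + cxHessian n u z).det = (f z : ℂ)) →
      -- f ≥ 0 and g = f^{1/n} ∈ C^{0,α}(B̄_r)
      (∀ z ∈ closedBall (0 : EuclideanSpace ℂ (Fin n)) r, 0 ≤ f z) →
      (∀ z ∈ closedBall (0 : EuclideanSpace ℂ (Fin n)) r, g z = f z ^ ((n : ℝ)⁻¹)) →
      ContinuousOn g (closedBall 0 r) →
      -- φ is continuous on the sphere and u = φ on ∂B_r
      ContinuousOn φ (sphere 0 r) →
      (∀ z ∈ sphere (0 : EuclideanSpace ℂ (Fin n)) r, u z = φ z) →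
      ∀ Kφ K₀ K₁ Kg₀ Kg₁ : ℝ,
      (∀ x ∈ sphere (0 : EuclideanSpace ℂ (Fin n)) r,
        ∀ y ∈ sphere (0 : EuclideanSpace ℂ (Fin n)) r,
          |φ x - φ y| ≤ Kφ * ‖x - y‖ ^ α) →
      (∀ x ∈ ball (0 : EuclideanSpace ℂ (Fin n)) r, |g x| ≤ K₀) →
      (∀ x ∈ ball (0 : EuclideanSpace ℂ (Fin n)) r,
        ∀ y ∈ ball (0 : EuclideanSpace ℂ (Fin n)) r,
          |g x - g y| ≤ K₁ * ‖x - y‖ ^ α) →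
      (∀ i j : Fin n, ∀ x ∈ ball (0 : EuclideanSpace ℂ (Fin n)) r, ‖G x i j‖ ≤ Kg₀) →
      (∀ i j : Fin n, ∀ x ∈ ball (0 : EuclideanSpace ℂ (Fin n)) r,
        ∀ y ∈ ball (0 : EuclideanSpace ℂ (Fin n)) r,
          ‖G x i j - G y i j‖ ≤ Kg₁ * ‖x - y‖ ^ α) →
      -- conclusion
      ∀ x ∈ ball (0 : EuclideanSpace ℂ (Fin n)) ((1 - t) * r),
      ∀ y ∈ ball (0 : EuclideanSpace ℂ (Fin n)) ((1 - t) * r),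
        |u x - u y| ≤
          C * (Kφ + r ^ (2 - α) * (K₀ + r ^ α * K₁) + r ^ (2 - α) * (Kg₀ + r ^ α * Kg₁)) *
            ‖x - y‖ ^ α := by
  obtain ⟨M, hM, HM⟩ := InteriorHolder.exists_moebius_bounds (V := EuclideanSpace ℂ (Fin n))
    (((n + 1 : ℕ) : ℝ) * (2 * (n : ℝ)⁻¹)) (show 1 - t < 1 by linarith)
  refine ⟨4 * n * M ^ 3, fun α hα hα1 r hr u f g φ G _ _ hu2 hu hpsd hdet hf hg _ _ huφ
    Kφ K₀ K₁ Kg₀ Kg₁ hKφ hK₀ hK₁ hKg₀ hKg₁ => ?_⟩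
  obtain ⟨x₁, hx₁, y₁, hy₁, h₁⟩ := InteriorHolder.exists_ne_mem_ball hn hr
  obtain ⟨x₂, hx₂, y₂, hy₂, h₂⟩ := InteriorHolder.exists_ne_mem_sphere hn hr
  have pφ := InteriorHolder.nonneg_of_nonneg_le_mul_rpow (abs_nonneg _) h₂ (hKφ _ hx₂ _ hy₂)
  have p₀ := (abs_nonneg _).trans (hK₀ _ hx₁)
  have p₁ := InteriorHolder.nonneg_of_nonneg_le_mul_rpow (abs_nonneg _) h₁ (hK₁ _ hx₁ _ hy₁)
  have pg₀ := (norm_nonneg _).trans (hKg₀ ⟨0, hn⟩ ⟨0, hn⟩ _ hx₁)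
  have pg₁ := InteriorHolder.nonneg_of_nonneg_le_mul_rpow (norm_nonneg _) h₁
    (hKg₁ ⟨0, hn⟩ ⟨0, hn⟩ _ hx₁ _ hy₁)
  have hφ : ∀ x ∈ sphere (0 : EuclideanSpace ℂ (Fin n)) r,
      ∀ y ∈ sphere (0 : EuclideanSpace ℂ (Fin n)) r, |u x - u y| ≤ Kφ * ‖x - y‖ ^ α :=
    fun x hx y hy => by rw [huφ x hx, huφ y hy]; exact hKφ x hx y hy
  have hscale : ∀ x ∈ ball (0 : EuclideanSpace ℂ (Fin n)) ((1 - t) * r),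
      ‖r⁻¹ • x‖ ≤ 1 - t ∧ r • r⁻¹ • x = x := fun x hx => by
    rw [mem_ball_zero_iff] at hx
    refine ⟨?_, smul_inv_smul₀ hr.ne' x⟩
    rw [norm_smul, norm_inv, Real.norm_of_nonneg hr.le, inv_mul_le_iff₀ hr]
    linarith
  have key : ∀ x ∈ ball (0 : EuclideanSpace ℂ (Fin n)) ((1 - t) * r),
      ∀ y ∈ ball (0 : EuclideanSpace ℂ (Fin n)) ((1 - t) * r),
        u x - u y ≤ 4 * n * M ^ 3 * (Kφ + r ^ (2 - α) * (K₀ + r ^ α * K₁)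
          + r ^ (2 - α) * (Kg₀ + r ^ α * Kg₁)) * ‖x - y‖ ^ α := by
    intro x hx y hy
    obtain ⟨ha, hxa⟩ := hscale x hx
    obtain ⟨hb, hyb⟩ := hscale y hy
    rw [← hxa, ← hyb, ← smul_sub, norm_smul, Real.norm_of_nonneg hr.le]
    refine (InteriorHolder.sub_le_of_forall_isLocalMax (by linarith)
      (fun a b z ha hb hz => (HM a b z ha hb hz).1) hα hr hu pφ hφ ha hb fun δ p hp hmax =>
        InteriorHolder.le_of_isLocalMax_moebius hn (by linarith) hM HM hα hr hu2 hpsd hdet hf hg pg₀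
          p₁ pg₁ hK₀ hK₁ hKg₀ hKg₁ ha hb hp hmax).trans ?_
    refine InteriorHolder.estimate_combine hn hr hM hα hα1 (norm_nonneg _) ?_ pφ p₀ p₁ pg₀ pg₁
    exact (norm_sub_le _ _).trans (by linarith)
  intro x hx y hy
  rw [abs_sub_le_iff]
  exact ⟨key x hx y hy, by rw [norm_sub_rev]; exact key y hy x hx⟩
end
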